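/- arXiv:math/0610258 — 3 statements merged into one kernel-verified Lean document; each statement's English description precedes it below -/
import Mathlib

section
/- Let R be a commutative artinian ring and T a Hom-finite Krull-Schmidt R-linear triangulated category. Then both T_r and T_l are thick triangulated subcategories of T, i.e., they are triangulated subcategories closed under direct summands. -/
open CategoryTheory CategoryTheory.Limits CategoryTheory.Linear
open CategoryTheory.Pretriangulated ZeroObject

universe w v u

namespace GeneralizedSerreDuality

/-- `E` is a minimal injective cogenerator for the commutative ring `R`. -/
structure IsMinimalInjectiveCogenerator (R : Type u) [CommRing R]
    (E : Type u) [AddCommGroup E] [Module R E] : Prop where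
  injective : Module.Injective R E
  cogenerates : ∀ (M : Type u) [AddCommGroup M] [Module R M] (m : M), m ≠ 0 →
    ∃ f : M →ₗ[R] E, f m ≠ 0
  minimal : ∀ (E' : Type u) [AddCommGroup E'] [Module R E'], Module.Injective R E' →
    (∀ (M : Type u) [AddCommGroup M] [Module R M] (m : M), m ≠ 0 →
      ∃ f : M →ₗ[R] E', f m ≠ 0) →
    ∃ g : E →ₗ[R] E', Function.Injective g

section
variable (R : Type u) [CommRing R] (E : Type u) [AddCommGroup E] [Module R E]
variable {C : Type v} [Category.{w} C] [Preadditive C] [CategoryTheory.Linear R C]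

/-- `X ∈ C_r`: `D Hom(X, -)` is representable. -/
def MemR (X : C) : Prop :=
  ∃ (SX : C) (φ : ∀ Y : C, ((X ⟶ Y) →ₗ[R] E) ≃ₗ[R] (Y ⟶ SX)),
    ∀ ⦃Y Y' : C⦄ (g : Y ⟶ Y') (ψ : (X ⟶ Y') →ₗ[R] E),
      φ Y (ψ ∘ₗ Linear.rightComp R X g) = g ≫ φ Y' ψ

/-- `X ∈ C_l`: `D Hom(-, X)` is representable. -/
def MemL (X : C) : Prop :=
  ∃ (TX : C) (φ : ∀ Y : C, ((Y ⟶ X) →ₗ[R] E) ≃ₗ[R] (TX ⟶ Y)),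
    ∀ ⦃Y Y' : C⦄ (g : Y ⟶ Y') (ψ : (Y ⟶ X) →ₗ[R] E),
      φ Y' (ψ ∘ₗ Linear.leftComp R X g) = φ Y ψ ≫ g

end

/-- An additive category is Krull-Schmidt if every object is a finite direct sum of
objects with local endomorphism rings. -/
def IsKrullSchmidt (C : Type v) [Category.{w} C] [Preadditive C]
    [HasFiniteBiproducts C] : Prop :=
  ∀ X : C, ∃ (n : ℕ) (f : Fin n → C),
    Nonempty (X ≅ ⨁ f) ∧ ∀ i, IsLocalRing (End (f i))

/-- A predicate `P` on objects of a pretriangulated category determines a thick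
triangulated subcategory: it contains the zero object, is closed under isomorphisms,
shifts, extensions (two-out-of-three for distinguished triangles), and direct summands. -/
def IsThickTriangulatedSubcategory
    (C : Type v) [Category.{w} C] [Preadditive C] [HasZeroObject C] [HasShift C ℤ]
    [∀ n : ℤ, (shiftFunctor C n).Additive] [Pretriangulated C]
    (P : C → Prop) : Prop :=
  P (0 : C) ∧
  (∀ ⦃X Y : C⦄, (X ≅ Y) → P X → P Y) ∧
  (∀ (n : ℤ) (X : C), P X → P (X⟦n⟧)) ∧
  (∀ T : Triangle C, T ∈ (distTriang C) →
    ((P T.obj₁ → P T.obj₂ → P T.obj₃) ∧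
     (P T.obj₁ → P T.obj₃ → P T.obj₂) ∧
     (P T.obj₂ → P T.obj₃ → P T.obj₁))) ∧
  (∀ ⦃X Y : C⦄ (i : X ⟶ Y) (r : Y ⟶ X), i ≫ r = 𝟙 X → P Y → P X)

section InjectiveCogenerator

variable {R : Type u} [CommRing R]

/-- Over a Baer module `E`, a linear map to `E` that vanishes on `ker g` factors through `g`. -/
lemma exists_comp_eq_of_ker_le {E : Type*} [AddCommGroup E] [Module R E] (hE : Module.Baer R E)
    {M N : Type*} [AddCommGroup M] [Module R M] [AddCommGroup N] [Module R N]
    (g : M →ₗ[R] N) (ψ : M →ₗ[R] E) (h : ∀ m, g m = 0 → ψ m = 0) :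
    ∃ θ : N →ₗ[R] E, ∀ m, θ (g m) = ψ m := by
  have hinj : Function.Injective ((LinearMap.ker g).liftQ g le_rfl) := by
    rw [← LinearMap.ker_eq_bot, Submodule.ker_liftQ_eq_bot _ _ _ le_rfl]
  obtain ⟨θ, hθ⟩ := hE.extension_property _ hinj ((LinearMap.ker g).liftQ ψ fun m hm ↦ h m hm)
  refine ⟨θ, fun m ↦ ?_⟩
  exact LinearMap.congr_fun hθ ((LinearMap.ker g).mkQ m)

/-- A Baer module containing a nonzero vector annihilated by each given maximal ideal is a
cogenerator. -/
lemma exists_apply_ne_zero_of_maximal {E : Type*} [AddCommGroup E] [Module R E]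
    (hE : Module.Baer R E)
    (x : MaximalSpectrum R → E) (hx : ∀ 𝔪, x 𝔪 ≠ 0) (hx' : ∀ 𝔪, ∀ r ∈ 𝔪.asIdeal, r • x 𝔪 = 0)
    {M : Type*} [AddCommGroup M] [Module R M] (m : M) (hm : m ≠ 0) :
    ∃ f : M →ₗ[R] E, f m ≠ 0 := by
  have hne : LinearMap.ker (LinearMap.toSpanSingleton R M m) ≠ ⊤ := by
    intro h
    have : (1 : R) ∈ LinearMap.ker (LinearMap.toSpanSingleton R M m) := h ▸ Submodule.mem_top
    exact hm (by simpa using this)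
  obtain ⟨𝔪, h𝔪, hle⟩ := Ideal.exists_le_maximal _ hne
  obtain ⟨θ, hθ⟩ := exists_comp_eq_of_ker_le hE (LinearMap.toSpanSingleton R M m)
    (LinearMap.toSpanSingleton R E (x ⟨𝔪, h𝔪⟩)) fun r hr ↦ hx' ⟨𝔪, h𝔪⟩ r (hle hr)
  refine ⟨θ, fun h ↦ hx ⟨𝔪, h𝔪⟩ ?_⟩
  have := hθ 1
  simp_all

lemma isNoetherian_torsionBySet_mul [IsNoetherianRing R] {N : Type*} [AddCommGroup N] [Module R N]
    (I J : Ideal R) (hI : IsNoetherian R (Submodule.torsionBySet R N I))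
    (hJ : IsNoetherian R (Submodule.torsionBySet R N J)) :
    IsNoetherian R (Submodule.torsionBySet R N (I * J : Ideal R)) := by
  obtain ⟨s, rfl⟩ := (isNoetherianRing_iff_ideal_fg R).1 inferInstance I
  let g : Submodule.torsionBySet R N (Ideal.span (s : Set R) * J : Ideal R) →ₗ[R]
      (s → Submodule.torsionBySet R N J) :=
    LinearMap.pi fun i ↦ LinearMap.restrict (LinearMap.lsmul R N i.1) fun y hy ↦ by
      rw [Submodule.mem_torsionBySet_iff] at hy ⊢
      intro a
      have := hy ⟨i.1 * a.1, Ideal.mul_mem_mul (Ideal.subset_span i.2) a.2⟩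
      rw [LinearMap.lsmul_apply, smul_smul, mul_comm]
      exact this
  let k : LinearMap.ker g →ₗ[R] Submodule.torsionBySet R N (Ideal.span (s : Set R) : Ideal R) :=
    LinearMap.codRestrict _
      ((Submodule.subtype _) ∘ₗ (Submodule.subtype _)) fun y ↦ by
      change _ ∈ Submodule.torsionBySet R N ((Submodule.span R (s : Set R) : Ideal R) : Set R)
      rw [← Submodule.torsionBySet_eq_torsionBySet_span, Submodule.mem_torsionBySet_iff]
      intro a
      have := congrFun (LinearMap.mem_ker.1 y.2) a
      exact congrArg Subtype.val this
  have hk : IsNoetherian R (LinearMap.ker g) :=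
    isNoetherian_of_injective k fun a b hab ↦
      Subtype.ext (Subtype.ext (congrArg Subtype.val hab :))
  exact isNoetherian_of_range_eq_ker (LinearMap.ker g).subtype g (by simp)

/-- Over an artinian ring, a module with noetherian `𝔪`-torsion for all `𝔪` is noetherian. -/
lemma isNoetherian_of_torsionBySet [IsArtinianRing R] {N : Type*} [AddCommGroup N] [Module R N]
    (h : ∀ 𝔪 : Ideal R, 𝔪.IsMaximal → IsNoetherian R (Submodule.torsionBySet R N 𝔪)) :
    IsNoetherian R N := by
  obtain ⟨Z, hZ⟩ := PrimeSpectrum.exists_primeSpectrum_prod_le (R := R) ⊥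
  have key : ∀ Z : Multiset (PrimeSpectrum R), IsNoetherian R
      (Submodule.torsionBySet R N ((Z.map PrimeSpectrum.asIdeal).prod : Ideal R)) := by
    intro Z
    induction Z using Multiset.induction with
    | empty =>
      have : Submodule.torsionBySet R N
          (((0 : Multiset (PrimeSpectrum R)).map PrimeSpectrum.asIdeal).prod : Ideal R) = ⊥ := by
        rw [eq_bot_iff]
        intro x hx
        simpa using (Submodule.mem_torsionBySet_iff _ _).1 hx ⟨1, by simp⟩
      rw [this]
      infer_instance
    | cons p Z ih =>
      rw [Multiset.map_cons, Multiset.prod_cons]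
      exact isNoetherian_torsionBySet_mul _ _ (h _ inferInstance) ih
  have htop : Submodule.torsionBySet R N ((Z.map PrimeSpectrum.asIdeal).prod : Ideal R) = ⊤ := by
    rw [eq_top_iff]
    intro x _
    rw [Submodule.mem_torsionBySet_iff]
    intro a
    rw [(Submodule.mem_bot R).1 (hZ a.2), zero_smul]
  have := key Z
  rw [htop] at this
  exact isNoetherian_top_iff.1 this

/-- Every submodule `L` of a Baer module is contained in a direct summand that is an essential
extension of `L`. -/
lemma exists_essential_retract {E : Type*} [AddCommGroup E] [Module R E] (hE : Module.Baer R E)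
    (L : Submodule R E) :
    ∃ (N : Submodule R E) (p : E →ₗ[R] N), L ≤ N ∧ (∀ x : N, p x = x) ∧
      ∀ x ∈ N, x ≠ 0 → ∃ r : R, r • x ∈ L ∧ r • x ≠ 0 := by
  obtain ⟨N, hLN, hN⟩ := zorn_le_nonempty₀
    {N : Submodule R E | ∀ x ∈ N, x ≠ 0 → ∃ r : R, r • x ∈ L ∧ r • x ≠ 0} (by
      intro c hc hchain y hy
      refine ⟨sSup c, ?_, fun z hz ↦ le_sSup hz⟩
      intro x hx hx0
      obtain ⟨z, hz, hxz⟩ := (Submodule.mem_sSup_of_directed ⟨y, hy⟩ hchain.directedOn).1 hx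
      exact hc hz x hxz hx0) L (fun x hx hx0 ↦ ⟨1, by simpa using hx, by simpa using hx0⟩)
  obtain ⟨K, -, hK⟩ := zorn_le_nonempty₀
    {K : Submodule R E | ∀ x ∈ K, x ∈ N → x = 0} (by
      intro c hc hchain y hy
      refine ⟨sSup c, ?_, fun z hz ↦ le_sSup hz⟩
      intro x hx hxN
      obtain ⟨z, hz, hxz⟩ := (Submodule.mem_sSup_of_directed ⟨y, hy⟩ hchain.directedOn).1 hx
      exact hc hz x hxz hxN) ⊥ (fun x hx _ ↦ by simpa using hx)
  have hess : ∀ e : E, e ∉ K → ∃ r : R, ∃ x ∈ N, x ≠ 0 ∧ K.mkQ (r • e) = K.mkQ x := by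
    intro e he
    by_contra! hcon
    refine he (hK.2 (y := K ⊔ Submodule.span R {e}) ?_ le_sup_left
      (Submodule.mem_sup_right (Submodule.mem_span_singleton_self e)))
    intro x hx hxN
    by_contra hx0
    obtain ⟨k, hk, z, hz, rfl⟩ := Submodule.mem_sup.1 hx
    obtain ⟨r, rfl⟩ := Submodule.mem_span_singleton.1 hz
    refine hcon r _ hxN hx0 ?_
    rw [map_add, (Submodule.Quotient.mk_eq_zero K).2 hk |> (id : _ → K.mkQ k = 0), zero_add]
  obtain ⟨θ, hθ⟩ := exists_comp_eq_of_ker_le hE (K.mkQ ∘ₗ N.subtype) N.subtype (fun x hx ↦ by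
    have : (x : E) ∈ K := (Submodule.Quotient.mk_eq_zero K).1 hx
    exact hK.prop _ this x.2)
  have hθ' : ∀ x ∈ N, θ (K.mkQ x) = x := fun x hx ↦ hθ ⟨x, hx⟩
  have hrange : LinearMap.range θ ≤ N := by
    refine hN.2 ?_ fun x hx ↦ ⟨K.mkQ x, hθ' x hx⟩
    rintro _ ⟨y, rfl⟩ hy
    obtain ⟨e, rfl⟩ := K.mkQ_surjective y
    obtain ⟨r, x, hx, hx0, hrx⟩ := hess e fun he ↦ hy (by
      rw [(Submodule.Quotient.mk_eq_zero K).2 he |> (id : _ → K.mkQ e = 0), map_zero])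
    obtain ⟨r', h1, h2⟩ := hN.prop x hx hx0
    have : (r' * r) • θ (K.mkQ e) = r' • x := by
      rw [mul_smul, ← map_smul θ r, ← map_smul K.mkQ, hrx, hθ' x hx]
    exact ⟨r' * r, this ▸ h1, this ▸ h2⟩
  exact ⟨N, LinearMap.codRestrict N (θ ∘ₗ K.mkQ) fun e ↦ hrange ⟨_, rfl⟩, hLN,
    fun x ↦ Subtype.ext (hθ' x x.2), hN.prop⟩

lemma IsMinimalInjectiveCogenerator.exists_torsion
    {E : Type u} [AddCommGroup E] [Module R E] (hE : IsMinimalInjectiveCogenerator R E)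
    (𝔪 : MaximalSpectrum R) : ∃ x : E, x ≠ 0 ∧ ∀ r ∈ 𝔪.asIdeal, r • x = 0 := by
  obtain ⟨f, hf⟩ := hE.cogenerates (R ⧸ 𝔪.asIdeal) (Ideal.Quotient.mk _ 1)
    (by rw [Ne, Ideal.Quotient.eq_zero_iff_mem]; exact (Ideal.ne_top_iff_one _).1 𝔪.2.ne_top)
  refine ⟨_, hf, fun r hr ↦ ?_⟩
  rw [← map_smul]
  have : r • (Ideal.Quotient.mk 𝔪.asIdeal 1) = 0 := by
    rw [← Ideal.Quotient.mk_eq_mk, ← Submodule.Quotient.mk_smul, smul_eq_mul, mul_one,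
      Ideal.Quotient.mk_eq_mk, Ideal.Quotient.eq_zero_iff_mem]
    exact hr
  rw [this, map_zero]

lemma IsMinimalInjectiveCogenerator.baer
    {E : Type u} [AddCommGroup E] [Module R E] (hE : IsMinimalInjectiveCogenerator R E) :
    Module.Baer R E :=
  Module.Baer.of_injective hE.injective

/-- The cogenerator property holds for modules in every universe. -/
lemma IsMinimalInjectiveCogenerator.exists_apply_ne_zero
    {E : Type u} [AddCommGroup E] [Module R E] (hE : IsMinimalInjectiveCogenerator R E)
    {M : Type*} [AddCommGroup M] [Module R M] (m : M) (hm : m ≠ 0) :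
    ∃ f : M →ₗ[R] E, f m ≠ 0 := by
  choose x hx0 hx1 using hE.exists_torsion
  exact exists_apply_ne_zero_of_maximal hE.baer x hx0 hx1 m hm

lemma IsMinimalInjectiveCogenerator.isNoetherian [IsArtinianRing R]
    {E : Type u} [AddCommGroup E] [Module R E] (hE : IsMinimalInjectiveCogenerator R E) :
    IsNoetherian R E := by
  have hB := hE.baer
  choose x hx0 hx1 using hE.exists_torsion
  obtain ⟨N, p, hLN, hp, hess⟩ := exists_essential_retract hB (Submodule.span R (Set.range x))
  have hxN : ∀ 𝔪, x 𝔪 ∈ N := fun 𝔪 ↦ hLN (Submodule.subset_span ⟨𝔪, rfl⟩)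
  have hBN : Module.Baer R N := by
    intro I g
    obtain ⟨g', hg'⟩ := hB I (N.subtype ∘ₗ g)
    refine ⟨p ∘ₗ g', fun r hr ↦ ?_⟩
    rw [LinearMap.comp_apply, hg' r hr]
    exact hp _
  obtain ⟨j, hj⟩ := hE.minimal N hBN.injective fun M _ _ m hm ↦
    exists_apply_ne_zero_of_maximal hBN (fun 𝔪 ↦ ⟨x 𝔪, hxN 𝔪⟩)
      (fun 𝔪 h ↦ hx0 𝔪 (congrArg Subtype.val h)) (fun 𝔪 r hr ↦ Subtype.ext (hx1 𝔪 r hr)) m hm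
  have hL : IsNoetherian R (Submodule.span R (Set.range x)) :=
    isNoetherian_span_of_finite R (Set.finite_range x)
  have : IsNoetherian R N := by
    refine isNoetherian_of_torsionBySet fun 𝔪 h𝔪 ↦ ?_
    let k : Submodule.torsionBySet R N 𝔪 →ₗ[R] Submodule.span R (Set.range x) :=
      LinearMap.codRestrict _ (N.subtype ∘ₗ Submodule.subtype _) fun y ↦ by
        change ((y : N) : E) ∈ _
        by_cases hy : ((y : N) : E) = 0
        · rw [hy]
          exact zero_mem _
        obtain ⟨r, hr, hr0⟩ := hess _ (y : N).2 hy
        have htor : ∀ a ∈ 𝔪, a • ((y : N) : E) = 0 := fun a ha ↦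
          congrArg Subtype.val ((Submodule.mem_torsionBySet_iff _ _).1 y.2 ⟨a, ha⟩)
        obtain ⟨s, hs⟩ := h𝔪.exists_inv (x := r) fun hmem ↦ hr0 (htor r hmem)
        obtain ⟨i, hi, hsi⟩ := hs
        have : ((y : N) : E) = s • r • ((y : N) : E) := by
          conv_lhs => rw [← one_smul R ((y : N) : E), ← hsi]
          rw [add_smul, htor i hi, add_zero, mul_smul]
        rw [this]
        exact Submodule.smul_mem _ _ hr
    exact isNoetherian_of_injective k fun a b hab ↦
      Subtype.ext (Subtype.ext (congrArg Subtype.val hab :))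
  exact isNoetherian_of_injective j hj

/-- In an artinian module, a family of submodules with trivial intersection has a finite subfamily
with trivial intersection. -/
lemma exists_finset_inf_eq_bot {N ι : Type*} [AddCommGroup N] [Module R N] [IsArtinian R N]
    (K : ι → Submodule R N) (hK : ⨅ i, K i = ⊥) : ∃ s : Finset ι, s.inf K = ⊥ := by
  classical
  obtain ⟨_, ⟨s, rfl⟩, hs⟩ := IsArtinian.set_has_minimal
    (Set.range fun s : Finset ι ↦ s.inf K) (Set.range_nonempty _)
  refine ⟨s, ?_⟩
  rw [eq_bot_iff, ← hK, le_iInf_iff]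
  intro i
  have h := hs _ ⟨insert i s, rfl⟩
  simp only [Finset.inf_insert] at h
  by_contra hi
  exact h (lt_of_le_of_ne inf_le_right fun heq ↦ hi (inf_eq_right.1 heq))

/-- The cogenerator property with respect to an additional action of `R` on an abelian group. -/
lemma IsMinimalInjectiveCogenerator.exists_addMonoidHom
    {E : Type u} [AddCommGroup E] [Module R E] (hE : IsMinimalInjectiveCogenerator R E)
    {N : Type*} [AddCommGroup N] (ρ : R →+* AddMonoid.End N) (n : N) (hn : n ≠ 0) :
    ∃ l : N →+ E, (∀ r x, l (ρ r x) = r • l x) ∧ l n ≠ 0 := by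
  let _ : Module R N := Module.compHom N ρ
  obtain ⟨f, hf⟩ := hE.exists_apply_ne_zero n hn
  exact ⟨f.toAddMonoidHom, fun r x ↦ f.map_smul r x, hf⟩

end InjectiveCogenerator

section Representability

variable {R : Type u} [CommRing R] {E : Type u} [AddCommGroup E] [Module R E]
variable {C : Type v} [Category.{w} C] [Preadditive C] [CategoryTheory.Linear R C]

/-- A linear form on `X ⟶ S` that exhibits `S` as representing `D Hom(X, -)`. -/
structure IsTrace {X S : C} (t : (X ⟶ S) →ₗ[R] E) : Prop where
  eq_zero : ∀ ⦃U : C⦄ (g : U ⟶ S), (∀ f : X ⟶ U, t (f ≫ g) = 0) → g = 0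
  exists_eq : ∀ ⦃U : C⦄ (ψ : (X ⟶ U) →ₗ[R] E), ∃ g : U ⟶ S, ∀ f, t (f ≫ g) = ψ f

lemma memR_iff_exists_isTrace {X : C} :
    MemR R E X ↔ ∃ (S : C) (t : (X ⟶ S) →ₗ[R] E), IsTrace t := by
  constructor
  · rintro ⟨S, φ, hφ⟩
    have key : ∀ {U : C} (g : U ⟶ S), (φ S).symm (𝟙 S) ∘ₗ Linear.rightComp R X g =
        (φ U).symm g := by
      intro U g
      rw [LinearEquiv.eq_symm_apply, hφ]
      simp
    refine ⟨S, (φ S).symm (𝟙 S), ?_, ?_⟩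
    · intro U g hg
      rw [← (φ U).symm.map_eq_zero_iff, ← key]
      ext f
      exact hg f
    · intro U ψ
      refine ⟨φ U ψ, fun f ↦ ?_⟩
      simpa using LinearMap.congr_fun (key (φ U ψ)) f
  · rintro ⟨S, t, ht⟩
    let α : ∀ U : C, (U ⟶ S) →ₗ[R] ((X ⟶ U) →ₗ[R] E) := fun U ↦
      { toFun := fun g ↦ t ∘ₗ Linear.rightComp R X g
        map_add' := fun g g' ↦ by ext; simp
        map_smul' := fun r g ↦ by ext; simp }
    have hα : ∀ U, Function.Bijective (α U) := fun U ↦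
      ⟨(injective_iff_map_eq_zero _).2 fun g hg ↦ ht.eq_zero g (LinearMap.congr_fun hg),
        fun ψ ↦ (ht.exists_eq ψ).imp fun g hg ↦ LinearMap.ext hg⟩
    refine ⟨S, fun U ↦ (LinearEquiv.ofBijective (α U) (hα U)).symm, fun U U' g ψ ↦ ?_⟩
    rw [LinearEquiv.symm_apply_eq]
    obtain ⟨h, rfl⟩ := (hα U').2 ψ
    have : (LinearEquiv.ofBijective (α U') (hα U')).symm (α U' h) = h :=
      (LinearEquiv.ofBijective (α U') (hα U')).symm_apply_apply h
    rw [this]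
    ext f
    simp [α]

/-- If `D Hom(X, -)` is generated by a form `t` on `X ⟶ Q` and `Hom(-, Q) ⟶ D Hom(X, -)` splits,
then `D Hom(X, -)` is representable. -/
lemma memR_of_split_generator [IsIdempotentComplete C] {X Q : C} (t : (X ⟶ Q) →ₗ[R] E)
    (ht : ∀ ⦃U : C⦄ (ψ : (X ⟶ U) →ₗ[R] E), ∃ g : U ⟶ Q, ∀ f, t (f ≫ g) = ψ f)
    (e : Q ⟶ Q) (he : ∀ f, t (f ≫ e) = t f)
    (he0 : ∀ ⦃U : C⦄ (g : U ⟶ Q), (∀ f : X ⟶ U, t (f ≫ g) = 0) → g ≫ e = 0) :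
    MemR R E X := by
  have hee : e ≫ e = e := by
    have := he0 (e - 𝟙 Q) fun f ↦ by simp [he]
    simpa [sub_eq_zero] using this
  obtain ⟨A, d, c, hdc, hcd⟩ := IsIdempotentComplete.idempotents_split Q e hee
  refine memR_iff_exists_isTrace.2 ⟨A, t ∘ₗ Linear.rightComp R X d, ?_, ?_⟩
  · intro U g hg
    have := he0 (g ≫ d) fun f ↦ by simpa using hg f
    rw [← hcd, Category.assoc, reassoc_of% hdc] at this
    rw [← Category.comp_id g, ← hdc, reassoc_of% this, zero_comp]
  · intro U ψ
    obtain ⟨g, hg⟩ := ht ψ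
    refine ⟨g ≫ c, fun f ↦ ?_⟩
    rw [← hg, ← he]
    simp [hcd]

/-- If `D Hom(X, -)` embeds into a representable functor, it is representable. -/
lemma memR_of_embedding [IsIdempotentComplete C] (hE : Module.Baer R E) {X Q : C}
    (j : ∀ U : C, ((X ⟶ U) →ₗ[R] E) →+ (U ⟶ Q))
    (hj : ∀ ⦃U U' : C⦄ (g : U ⟶ U') (ψ : (X ⟶ U') →ₗ[R] E),
      j U (ψ ∘ₗ Linear.rightComp R X g) = g ≫ j U' ψ)
    (hj0 : ∀ ⦃U : C⦄ (ψ : (X ⟶ U) →ₗ[R] E), j U ψ = 0 → ψ = 0) :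
    MemR R E X := by
  let jX : ((X ⟶ X) →ₗ[R] E) →ₗ[R] (X ⟶ Q) :=
    { j X with
      map_smul' := fun r ψ ↦ by
        have : r • ψ = ψ ∘ₗ Linear.rightComp R X (r • 𝟙 X) := by ext; simp
        change j X (r • ψ) = r • j X ψ
        rw [this, hj]
        simp }
  obtain ⟨τ, hτ⟩ := exists_comp_eq_of_ker_le hE jX (LinearMap.applyₗ (𝟙 X)) fun ψ hψ ↦ by
    rw [hj0 ψ hψ, map_zero]
  have key : ∀ ⦃U : C⦄ (ψ : (X ⟶ U) →ₗ[R] E) (f : X ⟶ U), τ (f ≫ j U ψ) = ψ f := by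
    intro U ψ f
    rw [← hj]
    exact (hτ _).trans (by simp)
  refine memR_of_split_generator τ (fun U ψ ↦ ⟨j U ψ, key ψ⟩) (j Q τ) (key τ) fun U g hg ↦ ?_
  rw [← hj]
  convert map_zero (j U)
  ext f
  exact hg f

lemma MemR.of_retract [IsIdempotentComplete C] (hE : Module.Baer R E) {X Y : C}
    (i : X ⟶ Y) (r : Y ⟶ X) (hir : i ≫ r = 𝟙 X) (hY : MemR R E Y) : MemR R E X := by
  obtain ⟨S, φ, hφ⟩ := hY
  refine memR_of_embedding hE (Q := S)
    (fun U ↦ ((φ U).toLinearMap ∘ₗ LinearMap.lcomp R E (Linear.leftComp R U i)).toAddMonoidHom)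
    ?_ ?_
  · intro U U' g ψ
    change φ U _ = g ≫ φ U' _
    rw [← hφ]
    congr 1
    ext f
    simp
  · intro U ψ hψ
    replace hψ := (φ U).map_eq_zero_iff.1 hψ
    ext f
    have := LinearMap.congr_fun hψ (r ≫ f)
    simpa [reassoc_of% hir] using this

lemma memR_of_isZero {X : C} (hX : IsZero X) : MemR R E X := by
  refine memR_iff_exists_isTrace.2 ⟨X, 0, fun U g _ ↦ hX.eq_of_tgt _ _, fun U ψ ↦ ⟨0, fun f ↦ ?_⟩⟩
  rw [hX.eq_of_src f 0]
  simp

/-- `f` is a weak kernel of `g`, and `g` is a weak cokernel of `f`. -/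
structure IsExactPair {A B D : C} (f : A ⟶ B) (g : B ⟶ D) : Prop where
  zero : f ≫ g = 0
  exists_lift : ∀ ⦃U : C⦄ (h : U ⟶ B), h ≫ g = 0 → ∃ k, k ≫ f = h
  exists_desc : ∀ ⦃U : C⦄ (h : B ⟶ U), f ≫ h = 0 → ∃ k, g ≫ k = h

variable (C) in
/-- Every morphism has a weak cokernel of which it is a weak kernel, and dually. -/
structure HasExactPairs : Prop where
  exists_right : ∀ ⦃A B : C⦄ (f : A ⟶ B), ∃ (D : C) (g : B ⟶ D), IsExactPair f g
  exists_left : ∀ ⦃B D : C⦄ (g : B ⟶ D), ∃ (A : C) (f : A ⟶ B), IsExactPair f g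

/-- The middle term of a five-term exact sequence lies in `C_r` if the outer terms do. -/
lemma memR_of_exact [IsIdempotentComplete C] [HasBinaryBiproducts C] (hE : Module.Baer R E)
    (hC : HasExactPairs C) {X₁ X₂ X₃ X₄ X₅ : C}
    {f₁ : X₁ ⟶ X₂} {f₂ : X₂ ⟶ X₃} {f₃ : X₃ ⟶ X₄} {f₄ : X₄ ⟶ X₅}
    (h₁₂ : IsExactPair f₁ f₂) (h₂₃ : IsExactPair f₂ f₃) (h₃₄ : IsExactPair f₃ f₄)
    (h₁ : MemR R E X₁) (h₂ : MemR R E X₂) (h₄ : MemR R E X₄) (h₅ : MemR R E X₅) :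
    MemR R E X₃ := by
  obtain ⟨S₁, t₁, h₁⟩ := memR_iff_exists_isTrace.1 h₁
  obtain ⟨S₂, t₂, h₂⟩ := memR_iff_exists_isTrace.1 h₂
  obtain ⟨S₄, t₄, h₄⟩ := memR_iff_exists_isTrace.1 h₄
  obtain ⟨S₅, t₅, h₅⟩ := memR_iff_exists_isTrace.1 h₅
  -- the morphisms induced on the representing objects
  obtain ⟨θ, hθ⟩ := h₂.exists_eq (t₁ ∘ₗ Linear.leftComp R S₁ f₁)
  obtain ⟨ω, hω⟩ := h₅.exists_eq (t₄ ∘ₗ Linear.leftComp R S₄ f₄)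
  simp only [LinearMap.comp_apply, Linear.leftComp_apply] at hθ hω
  have hθ' : ∀ {U : C} (y : X₂ ⟶ U) (c : U ⟶ S₁), t₂ (y ≫ c ≫ θ) = t₁ (f₁ ≫ y ≫ c) :=
    fun y c ↦ by simpa using hθ (y ≫ c)
  -- exactness of `D Hom(-, U)` at `X₂` and `X₃`
  have exact₂ : ∀ {U : C} (a : U ⟶ S₂), (∀ x : X₃ ⟶ U, t₂ (f₂ ≫ x ≫ a) = 0) →
      ∃ c, c ≫ θ = a := by
    intro U a ha
    obtain ⟨τ, hτ⟩ := exists_comp_eq_of_ker_le hE (Linear.leftComp R U f₁)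
      (t₂ ∘ₗ Linear.rightComp R X₂ a) fun y hy ↦ by
        obtain ⟨x, rfl⟩ := h₁₂.exists_desc y hy
        simpa using ha x
    obtain ⟨c, hc⟩ := h₁.exists_eq τ
    refine ⟨c, sub_eq_zero.1 (h₂.eq_zero _ fun y ↦ ?_)⟩
    have := hτ y
    simp only [LinearMap.comp_apply, Linear.leftComp_apply, Linear.rightComp_apply] at this
    rw [Preadditive.comp_sub, map_sub, hθ', ← this, ← hc, Category.assoc, sub_self]
  have exact₃ : ∀ {U : C} (ψ : (X₃ ⟶ U) →ₗ[R] E), (∀ h : X₄ ⟶ U, ψ (f₃ ≫ h) = 0) →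
      ∃ a : U ⟶ S₂, ∀ x, t₂ (f₂ ≫ x ≫ a) = ψ x := by
    intro U ψ hψ
    obtain ⟨τ, hτ⟩ := exists_comp_eq_of_ker_le hE (Linear.leftComp R U f₂) ψ fun x hx ↦ by
      obtain ⟨h, rfl⟩ := h₂₃.exists_desc x hx
      exact hψ h
    obtain ⟨a, ha⟩ := h₂.exists_eq τ
    exact ⟨a, fun x ↦ by rw [← hτ x, ← ha]; simp⟩
  obtain ⟨K, κ, hκ⟩ := hC.exists_left ω
  obtain ⟨L, l, hl⟩ := hC.exists_left κ
  obtain ⟨k, hk⟩ := exists_comp_eq_of_ker_le hE (Linear.leftComp R K f₃)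
    (t₄ ∘ₗ Linear.rightComp R X₄ κ) fun h hh ↦ by
      obtain ⟨h', rfl⟩ := h₃₄.exists_desc h hh
      have := hω (h' ≫ κ)
      simp only [Category.assoc, hκ.zero, comp_zero, map_zero] at this
      simpa using this.symm
  simp only [LinearMap.comp_apply, Linear.leftComp_apply, Linear.rightComp_apply] at hk
  obtain ⟨m, hm⟩ := exact₃ (k ∘ₗ Linear.rightComp R X₃ l) fun h ↦ by
    simpa [hl.zero] using hk (h ≫ l)
  simp only [LinearMap.comp_apply, Linear.rightComp_apply] at hm
  -- a presentation `S₁ ⊞ L ⟶ S₂ ⊞ K` of `D Hom(X₃, -)`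
  let p : (X₃ ⟶ S₂ ⊞ K) →ₗ[R] E :=
    t₂ ∘ₗ Linear.leftComp R S₂ f₂ ∘ₗ Linear.rightComp R X₃ biprod.fst +
      k ∘ₗ Linear.rightComp R X₃ biprod.snd
  have hp : ∀ x, p x = t₂ (f₂ ≫ x ≫ biprod.fst) + k (x ≫ biprod.snd) := fun x ↦ rfl
  let δ : S₁ ⊞ L ⟶ S₂ ⊞ K := biprod.desc (θ ≫ biprod.inl) (biprod.lift (-m) l)
  have hδ₁ : δ ≫ biprod.fst = biprod.fst ≫ θ - biprod.snd ≫ m := by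
    ext <;> simp [δ]
  have hδ₂ : δ ≫ biprod.snd = biprod.snd ≫ l := by
    ext <;> simp [δ]
  have hgen : ∀ ⦃U : C⦄ (ψ : (X₃ ⟶ U) →ₗ[R] E), ∃ g : U ⟶ S₂ ⊞ K, ∀ f, p (f ≫ g) = ψ f := by
    intro U ψ
    obtain ⟨g, hg⟩ := h₄.exists_eq (ψ ∘ₗ Linear.leftComp R U f₃)
    simp only [LinearMap.comp_apply, Linear.leftComp_apply] at hg
    obtain ⟨b, rfl⟩ := hκ.exists_lift g (h₅.eq_zero _ fun h ↦ by
      have h1 := hω (h ≫ g)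
      have h2 := hg (f₄ ≫ h)
      simp only [Category.assoc] at h1 h2
      rw [h1, h2, reassoc_of% h₃₄.zero, zero_comp, map_zero])
    obtain ⟨a, ha⟩ := exact₃ (ψ - k ∘ₗ Linear.rightComp R X₃ b) fun h ↦ by
      have h1 := hk (h ≫ b)
      simp only [Category.assoc] at h1
      simp [h1, hg]
    exact ⟨biprod.lift a b, fun f ↦ by simp [hp, ha]⟩
  have hrel : ∀ {U : C} (g : U ⟶ S₂ ⊞ K), (∀ x : X₃ ⟶ U, p (x ≫ g) = 0) → ∃ v, v ≫ δ = g := by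
    intro U g hg
    obtain ⟨c, hc⟩ := hl.exists_lift (g ≫ biprod.snd) (h₄.eq_zero _ fun h ↦ by
      have h1 := hg (f₃ ≫ h)
      have h2 := hk (h ≫ g ≫ biprod.snd)
      rw [hp] at h1
      simp only [Category.assoc, reassoc_of% h₂₃.zero, zero_comp, map_zero, zero_add] at h1 h2 ⊢
      rw [← h2, h1])
    obtain ⟨d, hd⟩ := exact₂ (g ≫ biprod.fst + c ≫ m) fun x ↦ by
      have h1 := hg x
      have h2 := hm (x ≫ c)
      rw [hp] at h1
      simp only [Category.assoc, hc] at h1 h2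
      simp only [Preadditive.comp_add, map_add, h2, h1]
    refine ⟨biprod.lift d c, ?_⟩
    ext
    · simp [hδ₁, hd]
    · simp [hδ₂, hc]
  have hrel' : ∀ y : X₃ ⟶ S₁ ⊞ L, p (y ≫ δ) = 0 := by
    intro y
    have h1 := hθ' (f₂ ≫ y) biprod.fst
    have h2 := hm (y ≫ biprod.snd)
    simp only [Category.assoc, reassoc_of% h₁₂.zero, zero_comp, map_zero] at h1 h2
    rw [hp]
    simp [hδ₁, hδ₂, h1, h2]
  obtain ⟨Q, q, hq⟩ := hC.exists_right δ
  obtain ⟨t, ht⟩ := exists_comp_eq_of_ker_le hE (Linear.rightComp R X₃ q) p fun x hx ↦ by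
    obtain ⟨y, rfl⟩ := hq.exists_lift x hx
    exact hrel' y
  simp only [Linear.rightComp_apply] at ht
  obtain ⟨v, hv⟩ := hgen t
  have ht' : ∀ {U : C} (f : X₃ ⟶ U) (g : U ⟶ S₂ ⊞ K), t (f ≫ g ≫ q) = p (f ≫ g) :=
    fun f g ↦ by simpa using ht (f ≫ g)
  refine memR_of_split_generator t (fun U ψ ↦ ?_) (v ≫ q) (fun f ↦ by rw [ht', hv])
    fun U g hg ↦ ?_
  · obtain ⟨g, hg⟩ := hgen ψ
    exact ⟨g ≫ q, fun f ↦ by rw [ht', hg]⟩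
  · obtain ⟨y, hy⟩ := hrel (g ≫ v) fun x ↦ by rw [← Category.assoc, hv, hg]
    rw [← Category.assoc, ← hy, Category.assoc, hq.zero, comp_zero]

end Representability

section Equivalence

variable {R : Type u} [CommRing R] {E : Type u} [AddCommGroup E] [Module R E]
variable {C : Type v} [Category.{w} C] [Preadditive C] [CategoryTheory.Linear R C]

/-- The second `R`-module structure on the dual of `End (F X)`, transported along an additive
functor `F` which need not be `R`-linear. -/
def conjugateAction (F : C ⥤ C) [F.Additive] (X : C) :
    R →+* AddMonoid.End ((F.obj X ⟶ F.obj X) →ₗ[R] E) where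
  toFun r := (LinearMap.lcomp R E
    (Linear.rightComp R (F.obj X) (F.map (r • 𝟙 X)))).toAddMonoidHom
  map_one' := by
    ext χ f
    change χ (f ≫ F.map ((1 : R) • 𝟙 X)) = χ f
    simp
  map_mul' r s := by
    ext χ f
    change χ (f ≫ F.map ((r * s) • 𝟙 X)) = χ ((f ≫ F.map (r • 𝟙 X)) ≫ F.map (s • 𝟙 X))
    rw [Category.assoc, ← F.map_comp]
    simp [smul_smul, mul_comm]
  map_zero' := by
    ext χ f
    change χ (f ≫ F.map ((0 : R) • 𝟙 X)) = 0
    simp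
  map_add' r s := by
    ext χ f
    change χ (f ≫ F.map ((r + s) • 𝟙 X)) =
      χ (f ≫ F.map (r • 𝟙 X)) + χ (f ≫ F.map (s • 𝟙 X))
    rw [add_smul, F.map_add, Preadditive.comp_add, map_add]

lemma conjugateAction_apply (F : C ⥤ C) [F.Additive] {X : C} (r : R)
    (χ : (F.obj X ⟶ F.obj X) →ₗ[R] E) :
    conjugateAction F X r χ = χ ∘ₗ Linear.rightComp R (F.obj X) (F.map (r • 𝟙 X)) := rfl

/-- A semilinear form on the dual of `End (Φ X)` induces a natural transformation from
`D Hom(Φ X, -)` to a representable functor. -/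
lemma exists_natural_of_addMonoidHom (Φ : C ≌ C) [Φ.functor.Additive] {X S : C}
    (φ : ∀ Y : C, ((X ⟶ Y) →ₗ[R] E) ≃ₗ[R] (Y ⟶ S))
    (hφ : ∀ ⦃Y Y' : C⦄ (g : Y ⟶ Y') (ψ : (X ⟶ Y') →ₗ[R] E),
      φ Y (ψ ∘ₗ Linear.rightComp R X g) = g ≫ φ Y' ψ)
    (l : ((Φ.functor.obj X ⟶ Φ.functor.obj X) →ₗ[R] E) →+ E)
    (hl : ∀ (r : R) χ, l (conjugateAction Φ.functor X r χ) = r • l χ) :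
    ∃ j : ∀ U : C, ((Φ.functor.obj X ⟶ U) →ₗ[R] E) →+ (U ⟶ Φ.functor.obj S),
      (∀ ⦃U U' : C⦄ (g : U ⟶ U') (ψ : (Φ.functor.obj X ⟶ U') →ₗ[R] E),
        j U (ψ ∘ₗ Linear.rightComp R _ g) = g ≫ j U' ψ) ∧
      ∀ ⦃U : C⦄ (ψ : (Φ.functor.obj X ⟶ U) →ₗ[R] E), j U ψ = 0 →
        ∀ k, l (ψ ∘ₗ Linear.rightComp R _ k) = 0 := by
  let ψ' : ∀ U : C, ((Φ.functor.obj X ⟶ U) →ₗ[R] E) → ((X ⟶ Φ.inverse.obj U) →ₗ[R] E) :=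
    fun U ψ ↦
      { toFun := fun f ↦ l (ψ ∘ₗ Linear.rightComp R _ (Φ.functor.map f ≫ Φ.counit.app U))
        map_add' := fun f f' ↦ by
          rw [← map_add]
          congr 1
          ext h
          simp
        map_smul' := fun r f ↦ by
          rw [RingHom.id_apply, ← hl, conjugateAction_apply]
          congr 1
          ext h
          simp only [LinearMap.comp_apply, Linear.rightComp_apply, Category.assoc,
            ← Φ.functor.map_comp_assoc]
          simp }
  have hψ' : ∀ U ψ f,
      ψ' U ψ f = l (ψ ∘ₗ Linear.rightComp R _ (Φ.functor.map f ≫ Φ.counit.app U)) :=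
    fun _ _ _ ↦ rfl
  refine ⟨fun U ↦
    { toFun := fun ψ ↦ Φ.counitInv.app U ≫ Φ.functor.map (φ _ (ψ' U ψ))
      map_zero' := ?_
      map_add' := fun ψ₁ ψ₂ ↦ ?_ }, ?_, ?_⟩
  · have : ψ' U 0 = 0 := by
      ext f
      simp [hψ']
    simp [this]
  · have : ψ' U (ψ₁ + ψ₂) = ψ' U ψ₁ + ψ' U ψ₂ := by
      ext f
      simp [hψ', LinearMap.add_comp]
    simp [this, Φ.functor.map_add]
  · intro U U' g ψ
    have : ψ' U (ψ ∘ₗ Linear.rightComp R _ g) =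
        ψ' U' ψ ∘ₗ Linear.rightComp R X (Φ.inverse.map g) := by
      ext f
      simp only [hψ', LinearMap.comp_apply, Linear.rightComp_apply]
      congr 1
      ext h
      simp
    change Φ.counitInv.app U ≫ Φ.functor.map (φ _ _) =
      g ≫ Φ.counitInv.app U' ≫ Φ.functor.map (φ _ _)
    rw [this, hφ]
    simp
  · intro U ψ h k
    change Φ.counitInv.app U ≫ Φ.functor.map (φ _ (ψ' U ψ)) = 0 at h
    have h0 : φ _ (ψ' U ψ) = 0 := by
      apply Φ.functor.map_injective
      rw [← cancel_epi (Φ.counitInv.app U), h]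
      simp
    rw [LinearEquiv.map_eq_zero_iff] at h0
    obtain ⟨f, rfl⟩ : ∃ f, Φ.functor.map f ≫ Φ.counit.app U = k :=
      ⟨Φ.unit.app X ≫ Φ.inverse.map k, by simp⟩
    exact LinearMap.congr_fun h0 f

/-- `C_r` is stable under additive autoequivalences, even if these are not `R`-linear. -/
lemma MemR.map_equivalence [IsArtinianRing R] [IsIdempotentComplete C] [HasFiniteBiproducts C]
    (hE : IsMinimalInjectiveCogenerator R E) [∀ X Y : C, Module.Finite R (X ⟶ Y)]
    (Φ : C ≌ C) [Φ.functor.Additive] {X : C} (hX : MemR R E X) :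
    MemR R E (Φ.functor.obj X) := by
  obtain ⟨S, φ, hφ⟩ := hX
  let N := (Φ.functor.obj X ⟶ Φ.functor.obj X) →ₗ[R] E
  let T := {l : N →+ E // ∀ (r : R) χ, l (conjugateAction Φ.functor X r χ) = r • l χ}
  have hNoeth : IsNoetherian R E := hE.isNoetherian
  have hN : IsArtinian R N := by
    have : IsNoetherian R N := inferInstance
    infer_instance
  let K : T → Submodule R N := fun l ↦
    { carrier := {χ | ∀ h, l.1 (χ ∘ₗ Linear.rightComp R _ h) = 0}
      add_mem' := fun {χ₁ χ₂} h₁ h₂ h ↦ by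
        rw [LinearMap.add_comp, map_add, h₁, h₂, add_zero]
      zero_mem' := fun h ↦ by rw [LinearMap.zero_comp, map_zero]
      smul_mem' := fun r χ hχ h ↦ by
        convert hχ (r • h) using 2
        ext f
        change r • χ (f ≫ h) = χ (f ≫ (r • h))
        simp }
  obtain ⟨s, hs⟩ := exists_finset_inf_eq_bot K (by
    rw [eq_bot_iff]
    intro χ hχ
    rw [Submodule.mem_bot]
    by_contra h0
    obtain ⟨l, hl, hl0⟩ := hE.exists_addMonoidHom (conjugateAction Φ.functor X) χ h0
    have h1 : l (χ ∘ₗ Linear.rightComp R _ (𝟙 _)) = 0 := (Submodule.mem_iInf _).1 hχ ⟨l, hl⟩ (𝟙 _)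
    refine hl0 ?_
    convert h1
    ext
    simp)
  choose j hj hj0 using fun l : T ↦ exists_natural_of_addMonoidHom Φ φ hφ l.1 l.2
  refine memR_of_embedding hE.baer (Q := ⨁ fun _ : s ↦ Φ.functor.obj S) (fun U ↦
    { toFun := fun ψ ↦ biproduct.lift fun i ↦ j i.1 U ψ
      map_zero' := by
        ext
        simp
      map_add' := fun _ _ ↦ by
        ext
        simp }) ?_ ?_
  · intro U U' g ψ
    ext i
    simpa using hj i.1 g ψ
  · intro U ψ hψ
    have hψ' : ∀ i ∈ s, ∀ k, i.1 (ψ ∘ₗ Linear.rightComp R _ k) = 0 := fun i hi ↦ hj0 i ψ (by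
      have := congrArg (· ≫ biproduct.π _ (⟨i, hi⟩ : s)) hψ
      simpa using this)
    ext k
    have hmem : ψ ∘ₗ Linear.rightComp R _ k ∈ s.inf K := by
      rw [Submodule.mem_finsetInf]
      intro i hi h
      convert hψ' i hi (h ≫ k) using 2
      ext
      simp
    rw [hs, Submodule.mem_bot] at hmem
    simpa using LinearMap.congr_fun hmem (𝟙 _)

end Equivalence

section KrullSchmidt

variable {C : Type v} [Category.{w} C] [Preadditive C]

/-- If the component of an idempotent `e` at a direct summand `Y` is invertible, then `e` dominates
an idempotent which splits through `Y` and whose complement splits through the complement of `Y`. -/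
lemma exists_exchange {P Y Z : C} {ι : Y ⟶ P} {π : P ⟶ Y} {j : Z ⟶ P} {q : P ⟶ Z}
    (hjq : j ≫ q = 𝟙 Z) (htot : π ≫ ι + q ≫ j = 𝟙 P)
    (e : P ⟶ P) (he : e ≫ e = e) [IsIso (ι ≫ e ≫ π)] :
    ∃ (a : Y ⟶ P) (b : P ⟶ Y) (s : Z ⟶ P) (r : P ⟶ Z),
      a ≫ b = 𝟙 Y ∧ s ≫ r = 𝟙 Z ∧ b ≫ a + r ≫ s = 𝟙 P ∧ a ≫ e = a ∧ e ≫ b = b := by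
  obtain ⟨v, huv, hvu⟩ : ∃ v, (ι ≫ e ≫ π) ≫ v = 𝟙 Y ∧ v ≫ ι ≫ e ≫ π = 𝟙 Y :=
    ⟨inv (ι ≫ e ≫ π), IsIso.hom_inv_id _, IsIso.inv_hom_id _⟩
  obtain ⟨a, ha⟩ : ∃ a, a = ι ≫ e := ⟨_, rfl⟩
  obtain ⟨b, hb⟩ : ∃ b, b = e ≫ π ≫ v := ⟨_, rfl⟩
  have hae : a ≫ e = a := by rw [ha, Category.assoc, he]
  have heb : e ≫ b = b := by rw [hb, reassoc_of% he]
  have haπ : a ≫ π ≫ v = 𝟙 Y := by simpa [ha] using huv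
  have hab : a ≫ b = 𝟙 Y := by rw [hb, reassoc_of% hae, haπ]
  have hvaπ : v ≫ a ≫ π = 𝟙 Y := by simpa [ha] using hvu
  have hjπ : j ≫ π = 0 := by
    have h1 : j ≫ π ≫ ι = 0 := by
      have h2 : j ≫ (π ≫ ι + q ≫ j) = j := by rw [htot, Category.comp_id]
      simpa [reassoc_of% hjq] using h2
    rw [← Category.comp_id π, ← huv]
    simp [reassoc_of% h1]
  have hq : q ≫ j = 𝟙 P - π ≫ ι := eq_sub_of_add_eq' htot
  obtain ⟨p, hp⟩ : ∃ p, p = π ≫ v ≫ a := ⟨_, rfl⟩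
  have hap : a ≫ p = a := by
    simpa [hp] using haπ =≫ a
  have hpπ : p ≫ π = π := by simp [hp, hvaπ]
  have hpb : p ≫ b ≫ a = p := by simp [hp, reassoc_of% hab]
  refine ⟨a, b, j ≫ (𝟙 P - b ≫ a), (𝟙 P - p) ≫ q, hab, ?_, ?_, hae, heb⟩
  · have h1 : a ≫ (𝟙 P - p) = 0 := by simp [hap]
    have h2 : (𝟙 P - b ≫ a) ≫ (𝟙 P - p) = 𝟙 P - p := by
      rw [Preadditive.sub_comp, Category.id_comp, Category.assoc, h1, comp_zero, sub_zero]
    have h3 : j ≫ p = 0 := by simp [hp, reassoc_of% hjπ]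
    rw [Category.assoc, reassoc_of% h2, ← Category.assoc, Preadditive.comp_sub, h3]
    simpa using hjq
  · have h1 : (𝟙 P - p) ≫ π = 0 := by simp [hpπ]
    have h2 : (𝟙 P - p) ≫ q ≫ j = 𝟙 P - p := by
      rw [hq, Preadditive.comp_sub, reassoc_of% h1]
      simp
    have h3 : (𝟙 P - p) ≫ (𝟙 P - b ≫ a) = 𝟙 P - b ≫ a := by
      simp [hpb]
    rw [Category.assoc (𝟙 P - p), reassoc_of% h2, h3]
    abel

lemma exists_split_biproduct [HasFiniteBiproducts C] (n : ℕ) (f : Fin n → C)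
    (hf : ∀ i, IsLocalRing (End (f i))) (e : ⨁ f ⟶ ⨁ f) (he : e ≫ e = e) :
    ∃ (A : C) (i : A ⟶ ⨁ f) (p : ⨁ f ⟶ A), i ≫ p = 𝟙 A ∧ p ≫ i = e := by
  induction n with
  | zero =>
    refine ⟨⨁ f, 𝟙 _, 𝟙 _, by simp, ?_⟩
    ext i
    exact i.elim0
  | succ n ih =>
    let Z := ⨁ fun i : Fin n ↦ f i.succ
    let j : Z ⟶ ⨁ f := biproduct.desc fun i ↦ biproduct.ι f i.succ
    let q : ⨁ f ⟶ Z := biproduct.lift fun i ↦ biproduct.π f i.succ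
    let ι := biproduct.ι f 0
    let π := biproduct.π f 0
    have hjq : j ≫ q = 𝟙 Z := by
      ext i i'
      simp [j, q, Z, biproduct.ι_π, Fin.succ_inj]
    have htot : π ≫ ι + q ≫ j = 𝟙 (⨁ f) := by
      rw [← biproduct.total, Fin.sum_univ_succ]
      simp [j, q, biproduct.lift_desc, ι, π]
    have hιπ : ι ≫ π = 𝟙 _ := by simp [ι, π]
    have hsplit : ∀ {s : Z ⟶ ⨁ f} {r : ⨁ f ⟶ Z}, (s ≫ e ≫ r) ≫ (s ≫ e ≫ r) = s ≫ e ≫ r →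
        ∃ (A : C) (i : A ⟶ Z) (p : Z ⟶ A), i ≫ p = 𝟙 A ∧ p ≫ i = s ≫ e ≫ r :=
      fun h ↦ ih _ (fun i ↦ hf _) _ h
    have hloc := hf 0
    let u₁ : End (f 0) := ι ≫ e ≫ π
    let u₂ : End (f 0) := ι ≫ (𝟙 _ - e) ≫ π
    have hsum : u₁ + u₂ = 1 := by
      change ι ≫ e ≫ π + ι ≫ (𝟙 _ - e) ≫ π = 𝟙 (f 0)
      rw [← Preadditive.comp_add, ← Preadditive.add_comp, add_sub_cancel, Category.id_comp]
      exact hιπ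
    rcases IsLocalRing.isUnit_or_isUnit_of_add_one hsum with h | h
    · have : IsIso (ι ≫ e ≫ π) := (isUnit_iff_isIso _).1 h
      obtain ⟨a, b, s, r, hab, hsr, hid, hae, heb⟩ := exists_exchange hjq htot e he
      have hrs : r ≫ s = 𝟙 _ - b ≫ a := eq_sub_of_add_eq' hid
      have har : a ≫ r = 0 := by
        have : a ≫ r ≫ s = 0 := by simp [hrs, reassoc_of% hab]
        rw [← Category.comp_id r, ← hsr, reassoc_of% this, zero_comp]
      have hsb : s ≫ b = 0 := by
        have : r ≫ s ≫ b = 0 := by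
          rw [← Category.assoc, hrs]
          simp [hab]
        rw [← Category.id_comp s, ← hsr, Category.assoc, Category.assoc, this, comp_zero]
      obtain ⟨A, i, p, hip, hpi⟩ := hsplit (s := s) (r := r) (by
        simp only [Category.assoc]
        rw [reassoc_of% hrs]
        simp [reassoc_of% heb, reassoc_of% hsb, reassoc_of% he])
      have : HasBinaryBiproducts C := hasBinaryBiproducts_of_finite_biproducts C
      refine ⟨A ⊞ f 0, biprod.desc (i ≫ s) a, biprod.lift (r ≫ p) b, ?_, ?_⟩
      · ext
        · simp [reassoc_of% hsr, hip]
        · simp [hsb]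
        · simp [reassoc_of% har]
        · simp [hab]
      · rw [biprod.lift_desc, Category.assoc, reassoc_of% hpi, reassoc_of% hrs, hrs]
        simp [hae, reassoc_of% heb, reassoc_of% hab]
    · have : IsIso (ι ≫ (𝟙 _ - e) ≫ π) := (isUnit_iff_isIso _).1 h
      obtain ⟨a, b, s, r, hab, hsr, hid, hae, heb⟩ := exists_exchange hjq htot (𝟙 _ - e)
        (by simp [he])
      replace hae : a ≫ e = 0 := by simpa using hae
      replace heb : e ≫ b = 0 := by simpa using heb
      have hrs : r ≫ s = 𝟙 _ - b ≫ a := eq_sub_of_add_eq' hid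
      obtain ⟨A, i, p, hip, hpi⟩ := hsplit (s := s) (r := r) (by
        simp only [Category.assoc]
        rw [reassoc_of% hrs]
        simp [reassoc_of% heb, reassoc_of% he])
      refine ⟨A, i ≫ s, r ≫ p, by simp [reassoc_of% hsr, hip], ?_⟩
      rw [Category.assoc, reassoc_of% hpi, reassoc_of% hrs, hrs]
      simp [hae, reassoc_of% heb]

lemma IsKrullSchmidt.isIdempotentComplete [HasFiniteBiproducts C] (hC : IsKrullSchmidt C) :
    IsIdempotentComplete C := by
  refine ⟨fun X e he ↦ ?_⟩
  obtain ⟨n, f, ⟨φ⟩, hf⟩ := hC X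
  obtain ⟨A, i, p, hip, hpi⟩ := exists_split_biproduct n f hf (φ.inv ≫ e ≫ φ.hom)
    (by simp [reassoc_of% he])
  exact ⟨A, i ≫ φ.inv, φ.hom ≫ p, by simp [hip], by simp [reassoc_of% hpi]⟩

end KrullSchmidt

section Opposite

open Opposite

variable {R : Type u} [CommRing R] {E : Type u} [AddCommGroup E] [Module R E]
variable {C : Type v} [Category.{w} C] [Preadditive C]

instance linearOpposite [CategoryTheory.Linear R C] : CategoryTheory.Linear R Cᵒᵖ where
  homModule X Y := Equiv.module R (opEquiv X Y)
  smul_comp _ _ _ r f g :=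
    Quiver.Hom.unop_inj (Linear.comp_smul (R := R) _ _ _ g.unop r f.unop)
  comp_smul _ _ _ f r g :=
    Quiver.Hom.unop_inj (Linear.smul_comp (R := R) _ _ _ r g.unop f.unop)

variable (R) in
/-- Passing to opposite morphisms, as a linear equivalence. -/
def opLinearEquiv [CategoryTheory.Linear R C] (X Y : C) : (X ⟶ Y) ≃ₗ[R] (op Y ⟶ op X) where
  toFun f := f.op
  invFun f := f.unop
  map_add' _ _ := rfl
  map_smul' _ _ := rfl
  left_inv _ := rfl
  right_inv _ := rfl

lemma memL_iff_memR_op [CategoryTheory.Linear R C] {X : C} :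
    MemL R E X ↔ MemR R E (op X) := by
  constructor
  · rintro ⟨T, φ, hφ⟩
    refine ⟨op T, fun Y ↦ (LinearEquiv.congrLeft E R (opLinearEquiv R Y.unop X)).symm ≪≫ₗ
      φ Y.unop ≪≫ₗ opLinearEquiv R T Y.unop, fun Y Y' g ψ ↦ ?_⟩
    exact congrArg Quiver.Hom.op
      (hφ g.unop ((LinearEquiv.congrLeft E R (opLinearEquiv R Y'.unop X)).symm ψ))
  · rintro ⟨S, φ, hφ⟩
    refine ⟨S.unop, fun Y ↦ (LinearEquiv.congrLeft E R (opLinearEquiv R Y X)) ≪≫ₗ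
      φ (op Y) ≪≫ₗ (opLinearEquiv R S.unop Y).symm, fun Y Y' g ψ ↦ ?_⟩
    exact congrArg Quiver.Hom.unop
      (hφ g.op (LinearEquiv.congrLeft E R (opLinearEquiv R Y X) ψ))

lemma IsExactPair.op {A B D : C} {f : A ⟶ B} {g : B ⟶ D} (h : IsExactPair f g) :
    IsExactPair g.op f.op where
  zero := Quiver.Hom.unop_inj h.zero
  exists_lift U x hx := by
    obtain ⟨k, hk⟩ := h.exists_desc x.unop (Quiver.Hom.op_inj hx)
    exact ⟨k.op, Quiver.Hom.unop_inj hk⟩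
  exists_desc U x hx := by
    obtain ⟨k, hk⟩ := h.exists_lift x.unop (Quiver.Hom.op_inj hx)
    exact ⟨k.op, Quiver.Hom.unop_inj hk⟩

lemma HasExactPairs.op (hC : HasExactPairs C) : HasExactPairs Cᵒᵖ where
  exists_right A B f := by
    obtain ⟨D, g, h⟩ := hC.exists_left f.unop
    exact ⟨Opposite.op D, g.op, h.op⟩
  exists_left A B f := by
    obtain ⟨D, g, h⟩ := hC.exists_right f.unop
    exact ⟨Opposite.op D, g.op, h.op⟩

end Opposite

section Triangulated

variable {C : Type v} [Category.{w} C] [Preadditive C] [HasZeroObject C] [HasShift C ℤ]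
  [∀ n : ℤ, (shiftFunctor C n).Additive] [Pretriangulated C]

lemma isExactPair_of_distTriang (T : Triangle C) (hT : T ∈ distTriang C) :
    IsExactPair T.mor₁ T.mor₂ where
  zero := comp_distTriang_mor_zero₁₂ T hT
  exists_lift _ h hh := (T.coyoneda_exact₂ hT h hh).imp fun _ ↦ Eq.symm
  exists_desc _ h hh := (T.yoneda_exact₂ hT h hh).imp fun _ ↦ Eq.symm

variable (C) in
lemma hasExactPairs_of_pretriangulated : HasExactPairs C where
  exists_right A B f := by
    obtain ⟨D, g, h, hT⟩ := distinguished_cocone_triangle f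
    exact ⟨D, g, isExactPair_of_distTriang _ hT⟩
  exists_left B D g := by
    obtain ⟨A, f, h, hT⟩ := distinguished_cocone_triangle₁ g
    exact ⟨A, f, isExactPair_of_distTriang _ hT⟩

/-- A predicate stable under shifts and retracts, and under passing to the middle term of
five-term exact sequences, defines a thick triangulated subcategory. -/
lemma isThickTriangulatedSubcategory_of_exact {P : C → Prop} (hzero : P 0)
    (hshift : ∀ (n : ℤ) (X : C), P X → P (X⟦n⟧))
    (hretract : ∀ ⦃X Y : C⦄ (i : X ⟶ Y) (r : Y ⟶ X), i ≫ r = 𝟙 X → P Y → P X)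
    (hexact : ∀ ⦃X₁ X₂ X₃ X₄ X₅ : C⦄ ⦃f₁ : X₁ ⟶ X₂⦄ ⦃f₂ : X₂ ⟶ X₃⦄ ⦃f₃ : X₃ ⟶ X₄⦄
      ⦃f₄ : X₄ ⟶ X₅⦄, IsExactPair f₁ f₂ → IsExactPair f₂ f₃ → IsExactPair f₃ f₄ →
      P X₁ → P X₂ → P X₄ → P X₅ → P X₃) :
    IsThickTriangulatedSubcategory C P := by
  have h₃ : ∀ T : Triangle C, T ∈ distTriang C → P T.obj₁ → P T.obj₂ → P T.obj₃ :=
    fun T hT h1 h2 ↦ hexact (isExactPair_of_distTriang _ hT)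
      (isExactPair_of_distTriang _ (rot_of_distTriang _ hT))
      (isExactPair_of_distTriang _ (rot_of_distTriang _ (rot_of_distTriang _ hT)))
      h1 h2 (hshift 1 _ h1) (hshift 1 _ h2)
  refine ⟨hzero, fun X Y e ↦ hretract e.inv e.hom e.inv_hom_id, hshift, fun T hT ↦
    ⟨h₃ T hT, fun h1 h3 ↦ ?_, fun h2 h3 ↦ ?_⟩, hretract⟩
  · exact h₃ _ (inv_rot_of_distTriang _ hT) (hshift (-1) _ h3) h1
  · exact h₃ _ (inv_rot_of_distTriang _ (inv_rot_of_distTriang _ hT))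
      (hshift (-1) _ h2) (hshift (-1) _ h3)

end Triangulated

/-- **Proposition 2.5**: for a Hom-finite Krull-Schmidt `R`-linear triangulated category
`T`, both `T_r` and `T_l` are thick triangulated subcategories of `T`. -/
theorem memR_memL_thick_triangulated
    (R : Type u) [CommRing R] [IsArtinianRing R]
    (E : Type u) [AddCommGroup E] [Module R E]
    (hE : IsMinimalInjectiveCogenerator R E)
    (C : Type v) [Category.{w} C] [Preadditive C] [CategoryTheory.Linear R C]
    [HasZeroObject C] [HasShift C ℤ] [∀ n : ℤ, (shiftFunctor C n).Additive]
    [Pretriangulated C] [HasFiniteBiproducts C]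
    [∀ X Y : C, Module.Finite R (X ⟶ Y)]
    (hKS : IsKrullSchmidt C) :
    IsThickTriangulatedSubcategory C (MemR R E) ∧
    IsThickTriangulatedSubcategory C (MemL R E) := by
  have hI : IsIdempotentComplete C := hKS.isIdempotentComplete
  have hIop : IsIdempotentComplete Cᵒᵖ := Idempotents.isIdempotentComplete_iff_opposite.2 hI
  have hP := hasExactPairs_of_pretriangulated C
  have : HasFiniteBiproducts Cᵒᵖ := HasFiniteBiproducts.of_hasFiniteProducts
  have (X Y : Cᵒᵖ) : Module.Finite R (X ⟶ Y) :=
    Module.Finite.equiv (opLinearEquiv R Y.unop X.unop)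
  refine ⟨isThickTriangulatedSubcategory_of_exact (memR_of_isZero (isZero_zero C))
      (fun n X hX ↦
        have : (shiftEquiv C n).functor.Additive := inferInstanceAs (shiftFunctor C n).Additive
        hX.map_equivalence hE (shiftEquiv C n))
      (fun X Y i r hir hY ↦ hY.of_retract hE.baer i r hir)
      (fun _ _ _ _ _ _ _ _ _ h₁₂ h₂₃ h₃₄ ↦ memR_of_exact hE.baer hP h₁₂ h₂₃ h₃₄),
    isThickTriangulatedSubcategory_of_exact ?_ ?_ ?_ ?_⟩
  · exact memL_iff_memR_op.2 (memR_of_isZero (isZero_zero C).op)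
  · intro n X hX
    have : (shiftEquiv C n).op.functor.Additive :=
      inferInstanceAs (shiftFunctor C n).op.Additive
    exact memL_iff_memR_op.2 ((memL_iff_memR_op.1 hX).map_equivalence hE (shiftEquiv C n).op)
  · intro X Y i r hir hY
    exact memL_iff_memR_op.2 ((memL_iff_memR_op.1 hY).of_retract hE.baer r.op i.op
      (Quiver.Hom.unop_inj hir))
  · intro X₁ X₂ X₃ X₄ X₅ f₁ f₂ f₃ f₄ h₁₂ h₂₃ h₃₄ h₁ h₂ h₄ h₅
    rw [memL_iff_memR_op] at h₁ h₂ h₄ h₅ ⊢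
    exact memR_of_exact hE.baer hP.op h₃₄.op h₂₃.op h₁₂.op h₅ h₄ h₂ h₁

end GeneralizedSerreDuality
end

section
/- Let T be a Hom-finite Krull-Schmidt R-linear triangulated category and X ∈ T an indecomposable object. Then X ∈ T_r if and only if there exists an Auslander-Reiten triangle in T having X as its third term. -/
open CategoryTheory CategoryTheory.Limits CategoryTheory.Linear
open CategoryTheory.Pretriangulated ZeroObject

universe w v u

namespace GeneralizedSerreDuality

section
variable (C : Type v) [Category.{w} C] [Preadditive C] [HasZeroObject C] [HasShift C ℤ]
  [∀ n : ℤ, (shiftFunctor C n).Additive] [Pretriangulated C] [HasFiniteBiproducts C]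

/-- An Auslander-Reiten triangle: a distinguished triangle `X → Y → Z → X[1]` with `X`, `Z`
indecomposable, `w ≠ 0`, and `γ ≫ w = 0` for every non-retraction `γ : Y' ⟶ Z`. -/
def IsARTriangle (T : Triangle C) : Prop :=
  T ∈ (distTriang C) ∧ Indecomposable T.obj₁ ∧ Indecomposable T.obj₃ ∧
  T.mor₃ ≠ 0 ∧
  ∀ ⦃Y' : C⦄ (γ : Y' ⟶ T.obj₃), ¬IsSplitEpi γ → γ ≫ T.mor₃ = 0

end

section Modules

variable {R : Type u} [CommRing R]

lemma exists_le_maximal_disjoint {M : Type*} [AddCommGroup M] [Module R M]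
    {S V : Submodule R M} (h : Disjoint S V) :
    ∃ N, S ≤ N ∧ Maximal (fun N ↦ Disjoint N V) N := by
  refine zorn_le_nonempty₀ {N : Submodule R M | Disjoint N V} (fun c hc hchain N hN ↦ ?_) S h
  exact ⟨sSup c, (hchain.directedOn.disjoint_sSup_left).2 fun a ha ↦ hc ha,
    fun _ ↦ le_sSup⟩

/-- A complement of a submodule in an injective module is a direct summand, hence injective. -/
lemma injective_of_maximal_disjoint {E : Type u} [AddCommGroup E] [Module R E]
    (hE : Module.Injective R E) {N V : Submodule R E}
    (hN : Maximal (fun N ↦ Disjoint N V) N) : Module.Injective R N := by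
  obtain ⟨V', hVV', hV'⟩ := exists_le_maximal_disjoint hN.prop.symm
  obtain ⟨p, hp⟩ := hE.out (LinearMap.coprod N.subtype V'.subtype)
    (by
      rw [← LinearMap.ker_eq_bot, LinearMap.ker_coprod_of_disjoint_range _ _
        (by simpa using hV'.prop.symm), Submodule.ker_subtype, Submodule.ker_subtype,
        Submodule.prod_bot])
    (N.subtype ∘ₗ LinearMap.fst R N V')
  have hpN (n : E) (hn : n ∈ N) : p n = n := by simpa using hp (⟨n, hn⟩, 0)
  have hpV (v : E) (hv : v ∈ V') : p v = 0 := by simpa using hp (0, ⟨v, hv⟩)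
  have hdisj : Disjoint (LinearMap.range p) V' := by
    rw [Submodule.disjoint_def]
    rintro _ ⟨x, rfl⟩ hx
    have hle : Disjoint (V' ⊔ Submodule.span R {x}) N := by
      rw [Submodule.disjoint_def]
      intro n hn hnN
      obtain ⟨v, hv, y, hy, rfl⟩ := Submodule.mem_sup.1 hn
      obtain ⟨r, rfl⟩ := Submodule.mem_span_singleton.1 hy
      have h := hpN _ hnN
      rw [map_add, hpV v hv, zero_add, map_smul] at h
      exact Submodule.disjoint_def.1 hV'.prop _ (h ▸ V'.smul_mem r hx) hnN
    exact hpV x (hV'.le_of_ge hle le_sup_left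
      (Submodule.mem_sup_right (Submodule.mem_span_singleton_self x)))
  have hNp : N ≤ LinearMap.range p := fun n hn ↦ ⟨n, hpN n hn⟩
  have hpN' : LinearMap.range p ≤ N := hN.le_of_ge (hdisj.mono_right hVV') hNp
  refine ⟨fun X Y _ _ _ _ f hf g ↦ ?_⟩
  obtain ⟨h, hh⟩ := hE.out f hf (N.subtype ∘ₗ g)
  refine ⟨(p ∘ₗ h).codRestrict N fun y ↦ hpN' ⟨h y, rfl⟩, fun x ↦ Subtype.ext ?_⟩
  simp [hh, hpN]

/-- An injective module with nonzero `m`-torsion for each maximal ideal `m` is a cogenerator. -/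
lemma cogenerates_of_forall_isMaximal {E : Type u} [AddCommGroup E] [Module R E]
    (hE : Module.Injective R E)
    (h : ∀ m : Ideal R, m.IsMaximal → ∃ e : E, e ≠ 0 ∧ ∀ r ∈ m, r • e = 0)
    (M : Type u) [AddCommGroup M] [Module R M] (x : M) (hx : x ≠ 0) :
    ∃ f : M →ₗ[R] E, f x ≠ 0 := by
  obtain ⟨m, hm, hle⟩ := Ideal.exists_le_maximal (LinearMap.ker (LinearMap.toSpanSingleton R M x))
    (by
      rw [Ne, Ideal.eq_top_iff_one]
      simpa using hx)
  obtain ⟨e, he, hme⟩ := h m hm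
  obtain ⟨f, hf⟩ := hE.out
    ((LinearMap.ker (LinearMap.toSpanSingleton R M x)).liftQ _ le_rfl)
    (LinearMap.ker_eq_bot.1 (Submodule.ker_liftQ_eq_bot _ _ _ le_rfl))
    ((LinearMap.ker (LinearMap.toSpanSingleton R M x)).liftQ
      (LinearMap.toSpanSingleton R E e) fun r hr ↦ by simpa using hme r (hle hr))
  refine ⟨f, ?_⟩
  have := hf (Submodule.Quotient.mk 1)
  simp only [Submodule.liftQ_apply, LinearMap.toSpanSingleton_apply, one_smul] at this
  rwa [this]

variable {E : Type u} [AddCommGroup E] [Module R E]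

lemma IsMinimalInjectiveCogenerator.exists_ne_zero_smul_eq_zero
    (hE : IsMinimalInjectiveCogenerator R E) (m : Ideal R) (hm : m.IsMaximal) :
    ∃ e : E, e ≠ 0 ∧ ∀ r ∈ m, r • e = 0 := by
  obtain ⟨f, hf⟩ := hE.cogenerates (R ⧸ m) (Submodule.Quotient.mk 1) (by
    rw [Ne, Submodule.Quotient.mk_eq_zero]
    exact (Ideal.ne_top_iff_one m).1 hm.ne_top)
  refine ⟨_, hf, fun r hr ↦ ?_⟩
  rw [← map_smul, ← Submodule.Quotient.mk_smul, smul_eq_mul, mul_one,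
    (Submodule.Quotient.mk_eq_zero m).2 hr, map_zero]

/-- If `a` acts invertibly modulo `m` on an element killed by `m`, it can be cancelled. -/
lemma exists_smul_smul_eq {M : Type*} [AddCommGroup M] [Module R M] {m : Ideal R}
    (hm : m.IsMaximal) {a : R} (ha : a ∉ m) :
    ∃ b : R, ∀ x : M, (∀ r ∈ m, r • x = 0) → b • a • x = x := by
  obtain ⟨b, i, hi, hb⟩ := hm.exists_inv ha
  refine ⟨b, fun x hx ↦ ?_⟩
  rw [smul_smul]
  conv_rhs => rw [← one_smul R x, ← hb, add_smul, hx i hi, add_zero]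

/-- There is an injective cogenerator whose `m`-torsion is contained in a cyclic module killed
by `m`. -/
lemma IsMinimalInjectiveCogenerator.exists_cogenerator_with_cyclic_torsion
    (hE : IsMinimalInjectiveCogenerator R E) {m : Ideal R} (hm : m.IsMaximal) :
    ∃ N : Submodule R E, Module.Injective R N ∧
      (∀ (M : Type u) [AddCommGroup M] [Module R M] (x : M), x ≠ 0 →
        ∃ f : M →ₗ[R] N, f x ≠ 0) ∧
      ∃ x : N, (∀ r ∈ m, r • x = 0) ∧
        ∀ y : N, (∀ r ∈ m, r • y = 0) → ∃ s : R, y = s • x := by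
  obtain ⟨x, hx0, hx⟩ := hE.exists_ne_zero_smul_eq_zero m hm
  obtain ⟨V, -, hV⟩ := exists_le_maximal_disjoint (S := (⊥ : Submodule R E))
    (V := Submodule.span R {x}) disjoint_bot_left
  let K : Submodule R E := Submodule.torsionBySet R E m
  have hK (z : E) : z ∈ K ↔ ∀ r ∈ m, r • z = 0 := by
    simp [K, Submodule.mem_torsionBySet_iff]
  obtain ⟨N, hxN, hN⟩ := exists_le_maximal_disjoint (S := Submodule.span R {x}) (V := V ⊓ K)
    (hV.prop.symm.mono_right inf_le_left)
  have hxN' : x ∈ N := hxN (Submodule.mem_span_singleton_self x)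
  have hNinj := injective_of_maximal_disjoint hE.injective hN
  refine ⟨N, hNinj, cogenerates_of_forall_isMaximal hNinj fun m' hm' ↦ ?_,
    ⟨x, hxN'⟩, fun r hr ↦ Subtype.ext (hx r hr), fun y hy ↦ ?_⟩
  · by_cases hmm : m = m'
    · subst hmm
      exact ⟨⟨x, hxN'⟩, fun h ↦ hx0 (congrArg Subtype.val h),
        fun r hr ↦ Subtype.ext (hx r hr)⟩
    · obtain ⟨e, he0, he⟩ := hE.exists_ne_zero_smul_eq_zero m' hm'
      obtain ⟨i, hi, r, hr, hir⟩ := Submodule.mem_sup.1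
        ((Ideal.eq_top_iff_one _).1 (hm.coprime_of_ne hm' hmm))
      have hdisj : Disjoint (N ⊔ Submodule.span R {e}) (V ⊓ K) := by
        rw [Submodule.disjoint_def]
        intro v hv hvVK
        obtain ⟨n, hn, z, hz, hnz⟩ := Submodule.mem_sup.1 hv
        obtain ⟨t, rfl⟩ := Submodule.mem_span_singleton.1 hz
        have hrv : v = r • v := by
          conv_lhs => rw [← one_smul R v, ← hir, add_smul, (hK v).1 hvVK.2 i hi, zero_add]
        have hrn : v = r • n := by
          rw [hrv, ← hnz, smul_add, smul_comm, he r hr, smul_zero, add_zero]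
        exact Submodule.disjoint_def.1 hN.prop v (hrn ▸ N.smul_mem r hn) hvVK
      have heN : e ∈ N := hN.le_of_ge hdisj le_sup_left
        (Submodule.mem_sup_right (Submodule.mem_span_singleton_self e))
      exact ⟨⟨e, heN⟩, fun h ↦ he0 (congrArg Subtype.val h),
        fun r hr ↦ Subtype.ext (he r hr)⟩
  · obtain ⟨y, hyN⟩ := y
    have hyK (r : R) (hr : r ∈ m) : r • y = 0 := congrArg Subtype.val (hy r hr)
    by_cases hyV : y ∈ V
    · refine ⟨0, Subtype.ext ?_⟩
      simpa using Submodule.disjoint_def.1 hN.prop y hyN ⟨hyV, (hK y).2 hyK⟩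
    · have hnd : ¬ Disjoint (V ⊔ Submodule.span R {y}) (Submodule.span R {x}) := fun hd ↦
        hyV (hV.le_of_ge hd le_sup_left
          (Submodule.mem_sup_right (Submodule.mem_span_singleton_self y)))
      simp only [Submodule.disjoint_def, not_forall] at hnd
      obtain ⟨z, hz, hzx, hz0⟩ := hnd
      obtain ⟨v, hv, w, hw, hvw⟩ := Submodule.mem_sup.1 hz
      obtain ⟨r, rfl⟩ := Submodule.mem_span_singleton.1 hw
      obtain ⟨s, rfl⟩ := Submodule.mem_span_singleton.1 hzx
      have hveq : v = s • x - r • y := by rw [← hvw, add_sub_cancel_right]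
      have hvK : v ∈ K := by
        rw [hveq]
        exact K.sub_mem (K.smul_mem s ((hK x).2 hx)) (K.smul_mem r ((hK y).2 hyK))
      have hv0 : v = 0 := Submodule.disjoint_def.1 hN.prop v
        (hveq ▸ N.sub_mem (N.smul_mem s hxN') (N.smul_mem r hyN)) ⟨hv, hvK⟩
      rw [hv0, zero_add] at hvw
      have hrm : r ∉ m := fun hr ↦ hz0 (by rw [← hvw, hyK r hr])
      obtain ⟨b, hb⟩ := exists_smul_smul_eq (M := E) hm hrm
      refine ⟨b * s, Subtype.ext ?_⟩
      change y = (b * s) • x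
      rw [mul_smul, ← hvw, hb y hyK]

/-- The `m`-torsion of a minimal injective cogenerator is generated by each nonzero element. -/
lemma IsMinimalInjectiveCogenerator.exists_smul_eq
    (hE : IsMinimalInjectiveCogenerator R E) {m : Ideal R} (hm : m.IsMaximal) {x y : E}
    (hx0 : x ≠ 0) (hx : ∀ r ∈ m, r • x = 0) (hy : ∀ r ∈ m, r • y = 0) :
    ∃ r : R, r • x = y := by
  obtain ⟨N, hN, hcog, z, hz, hcyc⟩ := hE.exists_cogenerator_with_cyclic_torsion hm
  obtain ⟨g, hg⟩ := hE.minimal N hN hcog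
  obtain ⟨a, ha⟩ := hcyc (g x) fun r hr ↦ by rw [← map_smul, hx r hr, map_zero]
  obtain ⟨b, hb⟩ := hcyc (g y) fun r hr ↦ by rw [← map_smul, hy r hr, map_zero]
  have ham : a ∉ m := fun h ↦ hx0 (hg (by rw [ha, hz a h, map_zero]))
  obtain ⟨c, hc⟩ := exists_smul_smul_eq (M := N) hm ham
  refine ⟨b * c, hg ?_⟩
  rw [map_smul, mul_smul, ha, hc z hz, hb]

lemma IsMinimalInjectiveCogenerator.length_dual_le_one
    (hE : IsMinimalInjectiveCogenerator R E) (M : Type*) [AddCommGroup M] [Module R M]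
    [IsSimpleModule R M] : Module.length R (M →ₗ[R] E) ≤ 1 := by
  rcases subsingleton_or_nontrivial (M →ₗ[R] E) with h | h
  · simp
  · refine (Module.length_eq_one_iff.2 ?_).le
    have := IsSimpleModule.nontrivial R M
    obtain ⟨s, hs⟩ := exists_ne (0 : M)
    have hspan := IsSimpleModule.toSpanSingleton_surjective R hs
    have hmax := IsSimpleModule.ker_toSpanSingleton_isMaximal R hs
    have hkill (f : M →ₗ[R] E) (r : R)
        (hr : r ∈ LinearMap.ker (LinearMap.toSpanSingleton R M s)) : r • f s = 0 := by
      rw [← map_smul]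
      rw [LinearMap.mem_ker, LinearMap.toSpanSingleton_apply] at hr
      rw [hr, map_zero]
    have hext (f g : M →ₗ[R] E) (hfg : f s = g s) : f = g := by
      ext x
      obtain ⟨r, rfl⟩ := hspan x
      simp [hfg]
    refine isSimpleModule_iff_toSpanSingleton_surjective.2 ⟨h, fun f hf g ↦ ?_⟩
    have hfs : f s ≠ 0 := fun h0 ↦ hf (hext f 0 (by simpa using h0))
    obtain ⟨r, hr⟩ := hE.exists_smul_eq hmax hfs (hkill f) (hkill g)
    exact ⟨r, hext _ _ (by simpa using hr)⟩

lemma IsMinimalInjectiveCogenerator.length_dual_le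
    (hE : IsMinimalInjectiveCogenerator R E) {M : Type*} [AddCommGroup M] [Module R M]
    (hM : IsFiniteLength R M) : Module.length R (M →ₗ[R] E) ≤ Module.length R M := by
  induction hM with
  | of_subsingleton => simp
  | @of_simple_quotient M _ _ N _ _ ih =>
    let res : (M →ₗ[R] E) →ₗ[R] (N →ₗ[R] E) := LinearMap.lcomp R E N.subtype
    let infl : ((M ⧸ N) →ₗ[R] E) →ₗ[R] (M →ₗ[R] E) := LinearMap.lcomp R E N.mkQ
    have hker : LinearMap.ker res ≤ LinearMap.range infl := fun f hf ↦
      ⟨N.liftQ f fun x hx ↦ LinearMap.congr_fun hf ⟨x, hx⟩, LinearMap.ext fun _ ↦ rfl⟩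
    rw [Module.length_eq_add_of_exact (LinearMap.ker res).subtype res.rangeRestrict
        (Submodule.injective_subtype _) res.surjective_rangeRestrict (by
          rw [LinearMap.exact_iff]; simp),
      Module.length_eq_add_of_exact N.subtype N.mkQ N.injective_subtype N.mkQ_surjective
        (LinearMap.exact_subtype_mkQ N), add_comm]
    refine add_le_add ((Module.length_le_of_injective _ (Submodule.injective_subtype _)).trans ih)
      (((Module.length_le_of_injective _ (Submodule.inclusion_injective hker)).trans
        (Module.length_le_of_surjective _ infl.surjective_rangeRestrict)).trans ?_)
    rw [Module.length_eq_one R (M ⧸ N)]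
    exact hE.length_dual_le_one (M ⧸ N)

lemma IsMinimalInjectiveCogenerator.exists_ne_zero_of_finite
    (hE : IsMinimalInjectiveCogenerator R E) {M : Type*} [AddCommGroup M] [Module R M]
    [Module.Finite R M] {x : M} (hx : x ≠ 0) : ∃ f : M →ₗ[R] E, f x ≠ 0 := by
  obtain ⟨n, p, hp⟩ := Module.Finite.exists_fin' R M
  let e := p.quotKerEquivOfSurjective hp
  obtain ⟨f, hf⟩ := hE.cogenerates _ (e.symm x) (by simpa using hx)
  exact ⟨f ∘ₗ e.symm.toLinearMap, hf⟩

/-- A pairing of modules of finite length that is nondegenerate on both sides is perfect. -/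
lemma IsMinimalInjectiveCogenerator.bijective_flip_of_injective
    (hE : IsMinimalInjectiveCogenerator R E) {M N : Type*} [AddCommGroup M] [Module R M]
    [AddCommGroup N] [Module R N] (hM : IsFiniteLength R M) (hN : IsFiniteLength R N)
    (B : M →ₗ[R] N →ₗ[R] E) (hB : Function.Injective B) (hB' : Function.Injective B.flip) :
    Function.Bijective B.flip := by
  refine ⟨hB', LinearMap.range_eq_top.1 ?_⟩
  have hfin : IsFiniteLength R (M →ₗ[R] E) := Module.length_ne_top_iff.1
    (ne_top_of_le_ne_top (Module.length_ne_top_iff.2 hM) (hE.length_dual_le hM))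
  obtain ⟨_, _⟩ := isFiniteLength_iff_isNoetherian_isArtinian.1 hfin
  by_contra htop
  refine (Submodule.length_lt htop).not_ge ?_
  calc Module.length R (M →ₗ[R] E) ≤ Module.length R M := hE.length_dual_le hM
    _ ≤ Module.length R (N →ₗ[R] E) := Module.length_le_of_injective B hB
    _ ≤ Module.length R N := hE.length_dual_le hN
    _ = Module.length R (LinearMap.range B.flip) := (LinearEquiv.ofInjective _ hB').length_eq

end Modules

section Preadditive

variable {C : Type v} [Category.{w} C] [Preadditive C]

lemma isLocalRing_end_iff (X : C) :
    IsLocalRing (End X) ↔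
      ¬IsZero X ∧ ∀ f g : X ⟶ X, f + g = 𝟙 X → IsIso f ∨ IsIso g := by
  refine ⟨fun h ↦ ⟨fun h0 ↦ ?_, fun f g hfg ↦ ?_⟩, fun ⟨h0, h⟩ ↦ ?_⟩
  · exact one_ne_zero (α := End X) (h0.eq_of_src _ _)
  · simpa only [isUnit_iff_isIso] using
      IsLocalRing.isUnit_or_isUnit_of_add_one (R := End X) (a := f) (b := g) hfg
  · have : Nontrivial (End X) :=
      ⟨⟨𝟙 X, 0, fun h ↦ h0 ((IsZero.iff_id_eq_zero X).2 h)⟩⟩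
    refine ⟨fun {a b} hab ↦ ?_⟩
    simpa only [isUnit_iff_isIso] using h a b hab

lemma isLocalRing_end_obj {D : Type*} [Category* D] [Preadditive D] (F : C ⥤ D)
    [F.Full] [F.Faithful] [F.Additive] {X : C} (hX : IsLocalRing (End X)) :
    IsLocalRing (End (F.obj X)) := by
  rw [isLocalRing_end_iff] at hX ⊢
  refine ⟨fun h ↦ hX.1 ?_, fun f g hfg ↦ ?_⟩
  · rw [IsZero.iff_id_eq_zero] at h ⊢
    exact F.map_injective (by simpa using h)
  · obtain ⟨f, rfl⟩ := F.map_surjective f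
    obtain ⟨g, rfl⟩ := F.map_surjective g
    rw [← F.map_add, ← F.map_id] at hfg
    exact (hX.2 f g (F.map_injective hfg)).imp (fun (_ : IsIso f) ↦ inferInstanceAs (IsIso (F.map f)))
      (fun (_ : IsIso g) ↦ inferInstanceAs (IsIso (F.map g)))

lemma isLocalRing_end_of_iso {X Y : C} (e : X ≅ Y) (hX : IsLocalRing (End X)) :
    IsLocalRing (End Y) := by
  rw [isLocalRing_end_iff] at hX ⊢
  refine ⟨fun h ↦ hX.1 (h.of_iso e), fun f g hfg ↦ ?_⟩
  have hiso (f : Y ⟶ Y) (hf : IsIso (e.hom ≫ f ≫ e.inv)) : IsIso f := by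
    have : f = e.inv ≫ (e.hom ≫ f ≫ e.inv) ≫ e.hom := by simp
    rw [this]
    infer_instance
  exact (hX.2 (e.hom ≫ f ≫ e.inv) (e.hom ≫ g ≫ e.inv) (by
    rw [← Preadditive.comp_add, ← Preadditive.add_comp, hfg]
    simp)).imp (hiso f) (hiso g)

lemma indecomposable_of_isLocalRing_end [HasBinaryBiproducts C] {X : C}
    (hX : IsLocalRing (End X)) : Indecomposable X := by
  refine ⟨((isLocalRing_end_iff X).1 hX).1, fun Y Z e ↦ ?_⟩
  obtain ⟨-, h⟩ := (isLocalRing_end_iff _).1 (isLocalRing_end_of_iso e hX)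
  rcases h (biprod.fst ≫ biprod.inl) (biprod.snd ≫ biprod.inr) biprod.total with h | h
  · right
    rw [IsZero.iff_id_eq_zero]
    have h0 : (biprod.inr : Z ⟶ Y ⊞ Z) = 0 := by
      rw [← cancel_mono (biprod.fst ≫ biprod.inl : Y ⊞ Z ⟶ Y ⊞ Z)]
      simp
    rw [← biprod.inr_snd (X := Y), h0, zero_comp]
  · left
    rw [IsZero.iff_id_eq_zero]
    have h0 : (biprod.inl : Y ⟶ Y ⊞ Z) = 0 := by
      rw [← cancel_mono (biprod.snd ≫ biprod.inr : Y ⊞ Z ⟶ Y ⊞ Z)]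
      simp
    rw [← biprod.inl_fst (Y := Z), h0, zero_comp]

/-- The endomorphisms of an object with local endomorphism ring that are not retractions. -/
def nonRetractions (R : Type u) [Ring R] [CategoryTheory.Linear R C] (X : C)
    (hX : IsLocalRing (End X)) : Submodule R (X ⟶ X) where
  carrier := {f | ¬IsSplitEpi f}
  zero_mem' := fun ⟨⟨s⟩⟩ ↦ ((isLocalRing_end_iff X).1 hX).1
    ((IsZero.iff_id_eq_zero X).2 (by rw [← s.id, comp_zero]))
  add_mem' := by
    rintro f g hf hg ⟨⟨s⟩⟩
    have hs := s.id
    rw [Preadditive.comp_add] at hs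
    rcases ((isLocalRing_end_iff X).1 hX).2 _ _ hs with h | h
    · exact hf (IsSplitEpi.mk' ⟨inv (s.section_ ≫ f) ≫ s.section_, by simp⟩)
    · exact hg (IsSplitEpi.mk' ⟨inv (s.section_ ≫ g) ≫ s.section_, by simp⟩)
  smul_mem' := by
    rintro r f hf ⟨⟨s⟩⟩
    exact hf (IsSplitEpi.mk' ⟨r • s.section_, by
      rw [Linear.smul_comp, ← Linear.comp_smul, s.id]⟩)

/-- An object with local endomorphism ring in `C_r` admits a nonzero almost vanishing morphism. -/
lemma MemR.exists_almost_vanishing {R : Type u} [CommRing R] {E : Type u} [AddCommGroup E]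
    [Module R E] (hE : IsMinimalInjectiveCogenerator R E) [CategoryTheory.Linear R C]
    {X : C} [Module.Finite R (X ⟶ X)] (hX : IsLocalRing (End X)) (h : MemR R E X) :
    ∃ (S : C) (w : X ⟶ S), w ≠ 0 ∧ ∀ ⦃Y : C⦄ (γ : Y ⟶ X), ¬IsSplitEpi γ → γ ≫ w = 0 := by
  obtain ⟨S, φ, hφ⟩ := h
  obtain ⟨ψ, hψ⟩ := hE.exists_ne_zero_of_finite
    (M := (X ⟶ X) ⧸ nonRetractions R X hX) (x := Submodule.Quotient.mk (𝟙 X)) (by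
      rw [Ne, Submodule.Quotient.mk_eq_zero]
      exact fun h ↦ h inferInstance)
  refine ⟨S, φ X (ψ ∘ₗ (nonRetractions R X hX).mkQ), fun h0 ↦ hψ ?_, fun Y γ hγ ↦ ?_⟩
  · exact LinearMap.congr_fun ((φ X).map_eq_zero_iff.1 h0) (𝟙 X)
  · rw [← hφ]
    refine (φ Y).map_eq_zero_iff.2 (LinearMap.ext fun f ↦ ?_)
    have hmem : f ≫ γ ∈ nonRetractions R X hX := fun ⟨⟨s⟩⟩ ↦
      hγ (IsSplitEpi.mk' ⟨s.section_ ≫ f, by simp⟩)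
    simp [(Submodule.Quotient.mk_eq_zero _).2 hmem]

end Preadditive

section Triangulated

variable {C : Type v} [Category.{w} C] [Preadditive C] [HasZeroObject C] [HasShift C ℤ]
  [∀ n : ℤ, (shiftFunctor C n).Additive] [Pretriangulated C]

lemma isIso_of_isSplitMono_of_indecomposable [HasBinaryBiproducts C] {X Y : C} (i : Y ⟶ X)
    [IsSplitMono i] (hX : Indecomposable X) (hY : ¬IsZero Y) : IsIso i := by
  obtain ⟨Z, g, h, hT⟩ := distinguished_cocone_triangle i
  obtain ⟨e, -, -⟩ := exists_iso_binaryBiproduct_of_distTriang _ hT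
    (Triangle.mor₃_eq_zero_of_mono₁ _ hT (inferInstanceAs (Mono i)))
  exact (Triangle.isZero₃_iff_isIso₁ _ hT).1 ((hX.2 _ _ e).resolve_left hY)

lemma isLocalRing_end_of_indecomposable [HasFiniteBiproducts C] (hKS : IsKrullSchmidt C)
    {X : C} (hX : Indecomposable X) : IsLocalRing (End X) := by
  obtain ⟨n, f, ⟨e⟩, hf⟩ := hKS X
  obtain _ | n := n
  · refine absurd ?_ hX.1
    rw [IsZero.iff_id_eq_zero, ← cancel_mono e.hom]
    exact biproduct.hom_ext _ _ fun i ↦ i.elim0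
  · have : IsSplitMono (biproduct.ι f 0 ≫ e.inv) :=
      IsSplitMono.mk' ⟨e.hom ≫ biproduct.π f 0, by simp⟩
    have := isIso_of_isSplitMono_of_indecomposable (biproduct.ι f 0 ≫ e.inv) hX
      ((isLocalRing_end_iff _).1 (hf 0)).1
    exact isLocalRing_end_of_iso (asIso (biproduct.ι f 0 ≫ e.inv)) (hf 0)

lemma exists_comp_eq_of_almost_vanishing {X S Y : C} {w : X ⟶ S}
    (hw : ∀ ⦃Y : C⦄ (γ : Y ⟶ X), ¬IsSplitEpi γ → γ ≫ w = 0) (f : X ⟶ Y) (hf : f ≠ 0) :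
    ∃ g : Y ⟶ S, f ≫ g = w := by
  obtain ⟨Z, k, h, hT⟩ := distinguished_cocone_triangle₁ f
  have hkf : k ≫ f = 0 := comp_distTriang_mor_zero₁₂ _ hT
  obtain ⟨g, hg⟩ := Triangle.yoneda_exact₂ _ hT w
    (hw k fun _ ↦ hf (by rw [← cancel_epi k, hkf, comp_zero]))
  exact ⟨g, hg.symm⟩

lemma exists_comp_eq_of_almost_vanishing' {X S Y : C} {w : X ⟶ S} (hw0 : w ≠ 0)
    (hw : ∀ ⦃Y : C⦄ (γ : Y ⟶ X), ¬IsSplitEpi γ → γ ≫ w = 0)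
    (hS : IsLocalRing (End S)) (g : Y ⟶ S) (hg : g ≠ 0) :
    ∃ f : X ⟶ Y, f ≫ g = w := by
  obtain ⟨Z, c, h, hT⟩ := distinguished_cocone_triangle g
  have hgc : g ≫ c = 0 := comp_distTriang_mor_zero₁₂ _ hT
  have hwc : w ≫ c = 0 := by
    by_contra hne
    obtain ⟨s, hs⟩ := exists_comp_eq_of_almost_vanishing hw (w ≫ c) hne
    rw [Category.assoc] at hs
    rcases ((isLocalRing_end_iff S).1 hS).2 (c ≫ s) (𝟙 S - c ≫ s)
      (add_sub_cancel _ _) with hi | hi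
    · exact hg (by rw [← cancel_mono (c ≫ s), ← Category.assoc, hgc, zero_comp, zero_comp])
    · refine hw0 ?_
      rw [← cancel_mono (𝟙 S - c ≫ s), Preadditive.comp_sub, hs]
      simp
  obtain ⟨f, hf⟩ := Triangle.coyoneda_exact₂ _ hT w hwc
  exact ⟨f, hf.symm⟩

/-- A nonzero almost vanishing morphism to an object with local endomorphism ring induces a
perfect pairing. -/
lemma MemR.of_almost_vanishing {R : Type u} [CommRing R] [IsArtinianRing R] {E : Type u}
    [AddCommGroup E] [Module R E] (hE : IsMinimalInjectiveCogenerator R E)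
    [CategoryTheory.Linear R C] [∀ X Y : C, Module.Finite R (X ⟶ Y)]
    {X S : C} {w : X ⟶ S} (hw0 : w ≠ 0)
    (hw : ∀ ⦃Y : C⦄ (γ : Y ⟶ X), ¬IsSplitEpi γ → γ ≫ w = 0)
    (hS : IsLocalRing (End S)) : MemR R E X := by
  obtain ⟨θ, hθ⟩ := hE.exists_ne_zero_of_finite hw0
  have hfl (Y Z : C) : IsFiniteLength R (Y ⟶ Z) :=
    isFiniteLength_iff_isNoetherian_isArtinian.2 ⟨inferInstance, inferInstance⟩
  let B (Y : C) : (X ⟶ Y) →ₗ[R] (Y ⟶ S) →ₗ[R] E := (Linear.comp X Y S).compr₂ θ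
  have hB (Y : C) : Function.Bijective (B Y).flip := by
    refine hE.bijective_flip_of_injective (hfl _ _) (hfl _ _) _
      ((injective_iff_map_eq_zero _).2 fun f hf ↦ ?_)
      ((injective_iff_map_eq_zero _).2 fun g hg ↦ ?_)
    · by_contra hf0
      obtain ⟨g, rfl⟩ := exists_comp_eq_of_almost_vanishing hw f hf0
      exact hθ (LinearMap.congr_fun hf g)
    · by_contra hg0
      obtain ⟨f, rfl⟩ := exists_comp_eq_of_almost_vanishing' hw0 hw hS g hg0
      exact hθ (LinearMap.congr_fun hg f)
  refine ⟨S, fun Y ↦ (LinearEquiv.ofBijective _ (hB Y)).symm, fun Y Y' g ψ ↦ ?_⟩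
  rw [LinearEquiv.symm_apply_eq]
  obtain ⟨h, rfl⟩ := (LinearEquiv.ofBijective _ (hB Y')).surjective ψ
  ext f
  simp [B]

end Triangulated

/-- **Proposition 2.8(1)**: in a Hom-finite Krull-Schmidt `R`-linear triangulated category,
an indecomposable object `X` lies in `T_r` if and only if there is an Auslander-Reiten
triangle with `X` as its third term. -/
theorem memR_iff_exists_ARTriangle_third_term
    (R : Type u) [CommRing R] [IsArtinianRing R]
    (E : Type u) [AddCommGroup E] [Module R E]
    (hE : IsMinimalInjectiveCogenerator R E)
    (C : Type v) [Category.{w} C] [Preadditive C] [CategoryTheory.Linear R C]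
    [HasZeroObject C] [HasShift C ℤ] [∀ n : ℤ, (shiftFunctor C n).Additive]
    [Pretriangulated C] [HasFiniteBiproducts C]
    [∀ X Y : C, Module.Finite R (X ⟶ Y)]
    (hKS : IsKrullSchmidt C)
    (X : C) (hX : Indecomposable X) :
    MemR R E X ↔ ∃ T : Triangle C, IsARTriangle C T ∧ T.obj₃ = X := by
  constructor
  · intro h
    obtain ⟨S, w, hw0, hw⟩ :=
      h.exists_almost_vanishing hE (isLocalRing_end_of_indecomposable hKS hX)
    obtain ⟨n, f, ⟨e⟩, hf⟩ := hKS S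
    obtain ⟨i, hi⟩ : ∃ i, w ≫ e.hom ≫ biproduct.π f i ≠ 0 := by
      by_contra! h0
      refine hw0 ?_
      rw [← cancel_mono e.hom]
      exact biproduct.hom_ext _ _ fun i ↦ by simpa using h0 i
    obtain ⟨Y, a, b, hT⟩ := distinguished_cocone_triangle₂
      (w ≫ e.hom ≫ biproduct.π f i ≫ (shiftNegShift (f i) (1 : ℤ)).inv)
    refine ⟨_, ⟨hT, indecomposable_of_isLocalRing_end (isLocalRing_end_obj _ (hf i)), hX,
      fun h0 ↦ hi ?_, fun Y' (γ : Y' ⟶ X) hγ ↦ ?_⟩, rfl⟩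
    · rw [← cancel_mono (shiftNegShift (f i) (1 : ℤ)).inv, zero_comp, Category.assoc,
        Category.assoc]
      exact h0
    · have h0 {Z : C} (v : S ⟶ Z) : γ ≫ w ≫ v = 0 := by
        rw [← Category.assoc, hw γ hγ, zero_comp]
      exact h0 _
  · rintro ⟨T, ⟨-, hT₁, -, hw0, hw⟩, rfl⟩
    exact MemR.of_almost_vanishing hE hw0 hw
      (isLocalRing_end_obj _ (isLocalRing_end_of_indecomposable hKS hT₁))

end GeneralizedSerreDuality
end

section
/- Let T be a Hom-finite Krull-Schmidt R-linear triangulated category and X ∈ T an indecomposable object. Then X ∈ T_l if and only if there exists an Auslander-Reiten triangle in T having X as its first term. -/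
open CategoryTheory CategoryTheory.Limits CategoryTheory.Linear
open CategoryTheory.Pretriangulated ZeroObject

universe w v u

namespace GeneralizedSerreDuality

section Duality

variable {R : Type u} [CommRing R]

lemma exists_linearMap_apply_ne_zero_of_injective {E : Type u} [AddCommGroup E] [Module R E]
    (hE : Module.Injective R E)
    (h : ∀ I : Ideal R, I.IsMaximal → ∃ e : E, e ≠ 0 ∧ ∀ a ∈ I, a • e = 0)
    {M : Type*} [AddCommGroup M] [Module R M] {m : M} (hm : m ≠ 0) :
    ∃ f : M →ₗ[R] E, f m ≠ 0 := by
  let φ := LinearMap.toSpanSingleton R M m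
  have hφ : LinearMap.ker φ ≠ ⊤ := fun h' ↦ hm <| by
    have : (1 : R) ∈ LinearMap.ker φ := h' ▸ Submodule.mem_top
    simpa [φ] using this
  obtain ⟨I, hI, hle⟩ := Ideal.exists_le_maximal (LinearMap.ker φ) hφ
  obtain ⟨e, he, hIe⟩ := h I hI
  let g : (R ⧸ LinearMap.ker φ) →ₗ[R] E :=
    (LinearMap.ker φ).liftQ (LinearMap.toSpanSingleton R E e) fun a ha ↦ by
      simpa using hIe a (hle ha)
  obtain ⟨f, hf⟩ := Module.Injective.extension_property R E _ _
    ((LinearMap.ker φ).liftQ φ le_rfl)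
    (LinearMap.ker_eq_bot.1 (Submodule.ker_liftQ_eq_bot _ _ _ le_rfl)) g
  refine ⟨f, ?_⟩
  have h1 := LinearMap.congr_fun hf (Submodule.Quotient.mk 1)
  simp only [LinearMap.comp_apply, Submodule.liftQ_apply, g] at h1
  have h2 : f m = e := by simpa [φ] using h1
  exact h2 ▸ he

lemma injective_range_of_isIdempotentElem {E : Type u} [AddCommGroup E] [Module R E]
    (hE : Module.Injective R E) {q : Module.End R E} (hq : IsIdempotentElem q) :
    Module.Injective R (LinearMap.range q) where
  out X Y _ _ _ _ f hf g := by
    obtain ⟨h, hh⟩ := hE.out f hf ((LinearMap.range q).subtype ∘ₗ g)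
    refine ⟨q.rangeRestrict ∘ₗ h, fun x ↦ Subtype.ext ?_⟩
    obtain ⟨y, hy⟩ := (g x).2
    have : q (q y) = q y := LinearMap.congr_fun hq y
    simp [hh, ← hy, this]

/-- Restriction of endomorphisms to the part annihilated by an ideal. -/
def endRestrictTorsion (J : Ideal R) (E : Type*) [AddCommGroup E] [Module R E] :
    Module.End R E →+* Module.End R (Submodule.torsionBySet R E (J : Set R)) where
  toFun f := f.restrict fun x hx ↦ (Submodule.mem_torsionBySet_iff _ _).2 fun a ↦ by
    rw [← map_smul, (Submodule.mem_torsionBySet_iff _ _).1 hx a, map_zero]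
  map_one' := rfl
  map_mul' _ _ := rfl
  map_zero' := rfl
  map_add' _ _ := rfl

lemma isNilpotent_of_endRestrictTorsion_eq_zero {J : Ideal R} (hJ : IsNilpotent J)
    {E : Type*} [AddCommGroup E] [Module R E] {f : Module.End R E}
    (hf : endRestrictTorsion J E f = 0) : IsNilpotent f := by
  obtain ⟨n, hn⟩ := hJ
  have hf' : ∀ x : E, (∀ a ∈ J, a • x = 0) → f x = 0 := fun x hx ↦
    congrArg Subtype.val (LinearMap.congr_fun hf
      ⟨x, (Submodule.mem_torsionBySet_iff _ _).2 fun a ↦ hx a a.2⟩)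
  have key : ∀ (k : ℕ) (x : E), (∀ a ∈ J ^ k, a • x = 0) → (f ^ k) x = 0 := by
    intro k
    induction k with
    | zero => intro x hx; simpa using hx 1 (by simp)
    | succ k ih =>
      intro x hx
      rw [pow_succ, Module.End.mul_apply]
      refine ih _ fun a ha ↦ ?_
      rw [← map_smul]
      refine hf' _ fun b hb ↦ ?_
      rw [smul_smul, mul_comm]
      exact hx _ (pow_succ J k ▸ Ideal.mul_mem_mul ha hb)
  refine ⟨n, LinearMap.ext fun x ↦ key n x fun a ha ↦ ?_⟩
  rw [hn] at ha
  simp_all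

lemma endRestrictTorsion_surjective (J : Ideal R) {E : Type u} [AddCommGroup E] [Module R E]
    (hE : Module.Injective R E) : Function.Surjective (endRestrictTorsion J E) := fun p ↦ by
  obtain ⟨f, hf⟩ := Module.Injective.extension_property R E _ _
    (Submodule.torsionBySet R E (J : Set R)).subtype Subtype.val_injective
    ((Submodule.torsionBySet R E (J : Set R)).subtype ∘ₗ p)
  exact ⟨f, LinearMap.ext fun x ↦ Subtype.ext (LinearMap.congr_fun hf x)⟩

lemma isSemisimpleModule_torsionBySet_jacobson [IsArtinianRing R]
    (E : Type*) [AddCommGroup E] [Module R E] :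
    IsSemisimpleModule R (Submodule.torsionBySet R E (Ring.jacobson R : Set R)) := by
  have h : Module.IsTorsionBySet R (Submodule.torsionBySet R E (Ring.jacobson R : Set R))
    (Ring.jacobson R) := Submodule.torsionBySet_isTorsionBySet _
  let := h.module
  exact h.isSemisimpleModule_iff.1 inferInstance

lemma exists_injective_cogenerator_le_span [IsArtinianRing R]
    {E : Type u} [AddCommGroup E] [Module R E] (hE : Module.Injective R E)
    (hsimple : ∀ I : Ideal R, I.IsMaximal → ∃ e : E, e ≠ 0 ∧ ∀ a ∈ I, a • e = 0)
    (I : Ideal R) [I.IsMaximal] {x : E} (hx0 : x ≠ 0) (hx : ∀ a ∈ I, a • x = 0) :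
    ∃ E' : Submodule R E, Module.Injective R E' ∧
      (∀ I' : Ideal R, I'.IsMaximal → ∃ e : E', e ≠ 0 ∧ ∀ a ∈ I', a • e = 0) ∧
      ∀ y ∈ E', (∀ a ∈ I, a • y = 0) → ∃ r : R, y = r • x := by
  set J := Ring.jacobson R
  set S := Submodule.torsionBySet R E (J : Set R)
  have hss : IsSemisimpleModule R S := isSemisimpleModule_torsionBySet_jacobson E
  have memS : ∀ I' : Ideal R, I'.IsMaximal → ∀ y : E, (∀ a ∈ I', a • y = 0) → y ∈ S := by
    intro I' hI' y hy
    refine (Submodule.mem_torsionBySet_iff _ _).2 fun a ↦ hy a ?_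
    exact Submodule.mem_sInf.1 (Ring.jacobson_eq_sInf_isMaximal (R := R) ▸ SetLike.mem_coe.1 a.2)
      I' hI'
  let x' : S := ⟨x, memS I inferInstance x hx⟩
  let T : Submodule R S := Submodule.torsionBySet R S (I : Set R)
  obtain ⟨D, hD⟩ := exists_isCompl T
  let L : Submodule R S := Submodule.span R {x'}
  have hLT : L ≤ T := by
    rw [Submodule.span_singleton_le_iff_mem, Submodule.mem_torsionBySet_iff]
    exact fun a ↦ Subtype.ext (hx a a.2)
  obtain ⟨V, hV⟩ := exists_isCompl (L ⊔ D)
  let p : Module.End R S := (L ⊔ D).projection V hV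
  have hp : IsIdempotentElem p := Submodule.isIdempotentElem_projection hV
  obtain ⟨q, hq, hqp⟩ := exists_isIdempotentElem_eq_of_ker_isNilpotent (endRestrictTorsion J E)
    (fun f hf ↦ isNilpotent_of_endRestrictTorsion_eq_zero
      IsSemiprimaryRing.isNilpotent hf) p
    (endRestrictTorsion_surjective J hE p) hp
  have hqp' : ∀ s : S, q s = p s := fun s ↦ congrArg Subtype.val (LinearMap.congr_fun hqp s)
  have hpmem : ∀ s : S, s ∈ L ⊔ D → p s = s := fun s hs ↦
    Submodule.projection_apply_of_mem_left hV hs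
  have hpmem' : ∀ s : S, p s ∈ L ⊔ D := fun s ↦
    Submodule.projection_apply_mem hV s
  refine ⟨LinearMap.range q, injective_range_of_isIdempotentElem hE hq, fun I' hI' ↦ ?_, ?_⟩
  · suffices ∃ s : S, s ∈ L ⊔ D ∧ s ≠ 0 ∧ ∀ a ∈ I', a • s = 0 by
      obtain ⟨s, hs, hs0, hsI⟩ := this
      refine ⟨⟨s, s, by rw [hqp', hpmem s hs]⟩, fun h ↦ hs0 ?_, fun a ha ↦ ?_⟩
      · have h' := congrArg Subtype.val h
        exact Subtype.ext h'
      · have h' := congrArg Subtype.val (hsI a ha)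
        exact Subtype.ext h'
    by_cases hII : I' = I
    · subst hII
      refine ⟨x', Submodule.mem_sup_left (Submodule.mem_span_singleton_self _), ?_, ?_⟩
      · exact fun h ↦ hx0 (congrArg Subtype.val h)
      · exact fun a ha ↦ Subtype.ext (hx a ha)
    · obtain ⟨e, he, heI⟩ := hsimple I' hI'
      let e' : S := ⟨e, memS I' hI' e heI⟩
      obtain ⟨t, ht, d, hd, htd⟩ := Submodule.mem_sup.1
        (show e' ∈ T ⊔ D by rw [hD.sup_eq_top]; trivial)
      refine ⟨d, Submodule.mem_sup_right hd, ?_, fun a ha ↦ ?_⟩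
      · rintro rfl
        have hle : I ⊔ I' = ⊤ := Ideal.IsMaximal.coprime_of_ne ‹_› hI' (Ne.symm hII)
        obtain ⟨a, ha, b, hb, hab⟩ := Submodule.mem_sup.1
          (show (1 : R) ∈ I ⊔ I' by rw [hle]; trivial)
        apply he
        have h1 : a • e' = 0 := by
          rw [← htd, add_zero]
          exact (Submodule.mem_torsionBySet_iff _ _).1 ht ⟨a, ha⟩
        have h2 : a • e = 0 := congrArg Subtype.val h1
        rw [← one_smul R e, ← hab, add_smul, h2, heI b hb, add_zero]
      · have h0 : a • e' = 0 := Subtype.ext (heI a ha)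
        rw [← htd, smul_add] at h0
        have hmem : a • d ∈ T := by
          rw [eq_neg_of_add_eq_zero_right h0]
          exact neg_mem (T.smul_mem _ ht)
        simpa using hD.disjoint.le_bot ⟨hmem, D.smul_mem a hd⟩
  · rintro y ⟨z, rfl⟩ hy
    let s : S := ⟨q z, memS I inferInstance _ hy⟩
    have hs : p s = s := Subtype.ext <| by
      rw [← hqp']
      exact LinearMap.congr_fun hq z
    have hsT : s ∈ T := (Submodule.mem_torsionBySet_iff _ _).2 fun a ↦ Subtype.ext (hy a a.2)
    have hsL : s ∈ L := by
      have : (L ⊔ D) ⊓ T = L := by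
        rw [sup_inf_assoc_of_le _ hLT, inf_comm, hD.inf_eq_bot, sup_bot_eq]
      rw [← this]
      exact ⟨hs ▸ hpmem' s, hsT⟩
    obtain ⟨r, hr⟩ := Submodule.mem_span_singleton.1 hsL
    exact ⟨r, congrArg Subtype.val hr.symm⟩

namespace IsMinimalInjectiveCogenerator

variable {E : Type u} [AddCommGroup E] [Module R E]

lemma exists_ne_zero_smul_eq_zero_s9 (hE : IsMinimalInjectiveCogenerator R E)
    (I : Ideal R) (hI : I.IsMaximal) : ∃ e : E, e ≠ 0 ∧ ∀ a ∈ I, a • e = 0 := by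
  have : Nontrivial (R ⧸ I) := Ideal.Quotient.nontrivial_iff.2 hI.ne_top
  obtain ⟨f, hf⟩ := hE.cogenerates (R ⧸ I) 1 one_ne_zero
  refine ⟨f 1, hf, fun a ha ↦ ?_⟩
  rw [← map_smul, Algebra.smul_def, mul_one, Ideal.Quotient.algebraMap_eq,
    Ideal.Quotient.eq_zero_iff_mem.2 ha, map_zero]

lemma exists_apply_ne_zero_s9 (hE : IsMinimalInjectiveCogenerator R E)
    {M : Type*} [AddCommGroup M] [Module R M] {m : M} (hm : m ≠ 0) :
    ∃ f : M →ₗ[R] E, f m ≠ 0 :=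
  exists_linearMap_apply_ne_zero_of_injective hE.injective hE.exists_ne_zero_smul_eq_zero_s9 hm

lemma exists_eq_smul [IsArtinianRing R] (hE : IsMinimalInjectiveCogenerator R E)
    (I : Ideal R) [I.IsMaximal] {x y : E} (hx0 : x ≠ 0) (hx : ∀ a ∈ I, a • x = 0)
    (hy : ∀ a ∈ I, a • y = 0) : ∃ r : R, y = r • x := by
  obtain ⟨E', hE', hc, hspan⟩ := exists_injective_cogenerator_le_span hE.injective
    hE.exists_ne_zero_smul_eq_zero_s9 I hx0 hx
  obtain ⟨g, hg⟩ := hE.minimal E' hE' fun M _ _ m hm ↦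
    exists_linearMap_apply_ne_zero_of_injective hE' hc hm
  have key : ∀ z : E, (∀ a ∈ I, a • z = 0) → ∃ r : R, (g z : E) = r • x := fun z hz ↦
    hspan _ (g z).2 fun a ha ↦ by
      rw [← Submodule.coe_smul, ← map_smul, hz a ha, map_zero, Submodule.coe_zero]
  obtain ⟨a, ha⟩ := key x hx
  obtain ⟨c, hc⟩ := key y hy
  have haI : a ∉ I := fun h ↦ hx0 <| hg <| Subtype.ext <| by rw [ha, hx a h, map_zero]; rfl
  obtain ⟨b, i, hi, hb⟩ := Ideal.IsMaximal.exists_inv ‹_› haI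
  refine ⟨c * b, hg (Subtype.ext ?_)⟩
  rw [map_smul, Submodule.coe_smul, ha, hc, smul_smul, mul_assoc, mul_smul c (b * a),
    eq_sub_of_add_eq hb, sub_smul, hx i hi, one_smul, sub_zero]

lemma length_dual_le_s9 [IsArtinianRing R] (hE : IsMinimalInjectiveCogenerator R E)
    (N : Type*) [AddCommGroup N] [Module R N] [hN : Module.Finite R N] :
    Module.length R (N →ₗ[R] E) ≤ Module.length R N := by
  induction hN using IsNoetherianRing.induction_on_isQuotientEquivQuotientPrime with
  | subsingleton N =>
    rw [Module.length_eq_zero]; exact zero_le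
  | quotient N p e =>
    have hp : p.1.IsMaximal := inferInstance
    have hsimple : IsSimpleModule R (R ⧸ p.1) := isSimpleModule_iff_isCoatom.2 hp.out
    rw [e.length_eq, (LinearEquiv.congrLeft E R e).length_eq, Module.length_eq_one R (R ⧸ p.1)]
    have hann : ∀ (f : (R ⧸ p.1) →ₗ[R] E), ∀ a ∈ p.1, a • f 1 = 0 := fun f a ha ↦ by
      rw [← map_smul, Algebra.smul_def, mul_one, Ideal.Quotient.algebraMap_eq,
        Ideal.Quotient.eq_zero_iff_mem.2 ha, map_zero]
    have hext : ∀ (f g : (R ⧸ p.1) →ₗ[R] E), f 1 = g 1 → f = g := fun f g h ↦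
      Submodule.linearMap_qext _ (LinearMap.ext_ring h)
    rcases subsingleton_or_nontrivial ((R ⧸ p.1) →ₗ[R] E) with h | h
    · rw [Module.length_eq_zero]; exact zero_le
    · refine (Module.length_eq_one_iff.2 (isSimpleModule_iff_toSpanSingleton_surjective.2
        ⟨h, fun f hf g ↦ ?_⟩)).le
      obtain ⟨r, hr⟩ := hE.exists_eq_smul p.1 (x := f 1) (y := g 1)
        (fun h0 ↦ hf (hext _ _ (by simpa using h0))) (hann f) (hann g)
      exact ⟨r, hext _ _ (by simpa using hr.symm)⟩
  | exact N₁ N₂ N₃ f g hf hg hfg h₁ h₃ =>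
    have hex := LinearMap.exact_lcomp_of_exact_of_surjective E hfg hg
    rw [Module.length_eq_add_of_exact f g hf hg hfg,
      Module.length_eq_add_of_exact (LinearMap.ker (f.lcomp R E)).subtype
        (f.lcomp R E).rangeRestrict (Submodule.subtype_injective _)
        (LinearMap.surjective_rangeRestrict _)
        (by rw [LinearMap.exact_iff]; simp), add_comm]
    gcongr
    · exact (Module.length_le_of_injective _ (Submodule.subtype_injective _)).trans h₁
    · refine (Module.length_le_of_surjective
        ((g.lcomp R E).codRestrict (LinearMap.ker (f.lcomp R E)) fun φ ↦ hex.apply_apply_eq_zero φ)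
        ?_).trans h₃
      rintro ⟨φ, hφ⟩
      obtain ⟨ψ, rfl⟩ := (hex φ).1 hφ
      exact ⟨ψ, rfl⟩

lemma surjective_of_injective_of_injective [IsArtinianRing R]
    (hE : IsMinimalInjectiveCogenerator R E)
    {M N : Type*} [AddCommGroup M] [Module R M] [Module.Finite R M]
    [AddCommGroup N] [Module R N] [Module.Finite R N]
    (f : M →ₗ[R] N →ₗ[R] E) (hf : Function.Injective f) (hf' : Function.Injective f.flip) :
    Function.Surjective f := by
  have h1 : Module.length R (N →ₗ[R] E) ≤ Module.length R M :=
    ((hE.length_dual_le_s9 N).trans (Module.length_le_of_injective _ hf')).trans (hE.length_dual_le_s9 M)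
  have hM : Module.length R M ≠ ⊤ := Module.length_ne_top
  rw [Module.length_eq_add_of_exact f (LinearMap.range f).mkQ hf
    (Submodule.mkQ_surjective _) (LinearMap.exact_map_mkQ_range f)] at h1
  have h2 : Module.length R ((N →ₗ[R] E) ⧸ LinearMap.range f) = 0 := by
    have := (ENat.add_le_add_iff_left hM).1 (h1.trans (add_zero _).ge)
    simpa using this
  rw [Module.length_eq_zero_iff, Submodule.Quotient.subsingleton_iff] at h2
  exact LinearMap.range_eq_top.1 h2

end IsMinimalInjectiveCogenerator

end Duality

section LocalObjects

variable {C : Type v} [Category.{w} C] [Preadditive C]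

/-- A nonzero object all of whose endomorphisms `a` are such that `a` or `𝟙 - a` is invertible. -/
def HasLocalEnd (X : C) : Prop :=
  ¬IsZero X ∧ ∀ a : X ⟶ X, IsIso a ∨ IsIso (𝟙 X - a)

lemma hasLocalEnd_of_isLocalRing {X : C} (h : IsLocalRing (End X)) : HasLocalEnd X := by
  refine ⟨fun hX ↦ one_ne_zero (α := End X) (hX.eq_of_src _ _), fun a ↦ ?_⟩
  have := IsLocalRing.isUnit_or_isUnit_of_add_one (R := End X) (a := a) (b := 𝟙 X - a)
    (add_sub_cancel _ _)
  exact this.imp (isUnit_iff_isIso _).1 (isUnit_iff_isIso _).1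

namespace HasLocalEnd

lemma of_iso {X Y : C} (h : HasLocalEnd X) (e : X ≅ Y) : HasLocalEnd Y := by
  refine ⟨fun hY ↦ h.1 (hY.of_iso e), fun a ↦ ?_⟩
  have h1 : a = e.inv ≫ (e.hom ≫ a ≫ e.inv) ≫ e.hom := by simp
  have h2 : 𝟙 Y - a = e.inv ≫ (𝟙 X - e.hom ≫ a ≫ e.inv) ≫ e.hom := by simp
  rcases h.2 (e.hom ≫ a ≫ e.inv) with h' | h'
  · left; rw [h1]; infer_instance
  · right; rw [h2]; infer_instance

lemma map {D : Type*} [Category* D] [Preadditive D] {X : C} (h : HasLocalEnd X)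
    (F : C ⥤ D) [F.Full] [F.Faithful] [F.Additive] : HasLocalEnd (F.obj X) := by
  refine ⟨fun hX ↦ h.1 ?_, fun a ↦ ?_⟩
  · rw [IsZero.iff_id_eq_zero] at hX ⊢
    exact F.map_injective (by simpa using hX)
  · obtain ⟨a, rfl⟩ := F.map_surjective a
    rw [← F.map_id, ← F.map_sub]
    rcases h.2 a with h' | h'
    · exact Or.inl inferInstance
    · exact Or.inr inferInstance

lemma isIso_of_comp_eq {X Y : C} (h : HasLocalEnd X) {a : X ⟶ X} {f : X ⟶ Y} (hf : f ≠ 0)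
    (ha : a ≫ f = f) : IsIso a := by
  refine (h.2 a).resolve_right fun h' ↦ hf ?_
  rw [← cancel_epi (𝟙 X - a), Preadditive.sub_comp, ha, Category.id_comp, sub_self, comp_zero]

lemma isIso_of_comp_eq' {X Y : C} (h : HasLocalEnd X) {a : X ⟶ X} {f : Y ⟶ X} (hf : f ≠ 0)
    (ha : f ≫ a = f) : IsIso a := by
  refine (h.2 a).resolve_right fun h' ↦ hf ?_
  rw [← cancel_mono (𝟙 X - a), Preadditive.comp_sub, ha, Category.comp_id, sub_self, zero_comp]

lemma indecomposable [HasBinaryBiproducts C] {X : C} (h : HasLocalEnd X) :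
    Indecomposable X := by
  refine ⟨h.1, fun Y Z e ↦ ?_⟩
  have h' := h.of_iso e
  rcases h'.2 (biprod.fst ≫ biprod.inl) with h1 | h1
  · right
    rw [IsZero.iff_id_eq_zero]
    have : (biprod.inr : Z ⟶ Y ⊞ Z) = 0 := by
      rw [← cancel_mono (biprod.fst ≫ biprod.inl : Y ⊞ Z ⟶ Y ⊞ Z)]; simp
    rw [← biprod.inr_snd (X := Y), this, zero_comp]
  · left
    rw [IsZero.iff_id_eq_zero]
    have : (biprod.inl : Y ⟶ Y ⊞ Z) = 0 := by
      rw [← cancel_mono (𝟙 (Y ⊞ Z) - biprod.fst ≫ biprod.inl)]; simp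
    rw [← biprod.inl_fst (Y := Z), this, zero_comp]

end HasLocalEnd

/-- `θ : L ⟶ X` is nonzero and is annihilated by every morphism to `L` which is not a
retraction. -/
def IsAlmostVanishing {L X : C} (θ : L ⟶ X) : Prop :=
  θ ≠ 0 ∧ ∀ ⦃Y : C⦄ (γ : Y ⟶ L), ¬IsSplitEpi γ → γ ≫ θ = 0

variable {R : Type u} [CommRing R] [IsArtinianRing R] {E : Type u} [AddCommGroup E] [Module R E]
  [CategoryTheory.Linear R C] [∀ X Y : C, Module.Finite R (X ⟶ Y)]
  [HasFiniteBiproducts C]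

lemma MemL.exists_isAlmostVanishing (hE : IsMinimalInjectiveCogenerator R E)
    (hKS : IsKrullSchmidt C) {X : C} (hX0 : ¬IsZero X) (hX : MemL R E X) :
    ∃ (L : C) (θ : L ⟶ X), HasLocalEnd L ∧ IsAlmostVanishing θ := by
  obtain ⟨S, φ, hφ⟩ := hX
  let η : (S ⟶ X) →ₗ[R] E := (φ S).symm (𝟙 S)
  have hη {Y : C} (ψ : (Y ⟶ X) →ₗ[R] E) : ψ = η ∘ₗ Linear.leftComp R X (φ Y ψ) :=
    (φ Y).injective (by simp [hφ, η])
  obtain ⟨ψ₀, hψ₀⟩ := hE.exists_apply_ne_zero_s9 (R := R) (m := 𝟙 X)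
    (fun h ↦ hX0 ((IsZero.iff_id_eq_zero X).2 h))
  have hne : φ X ψ₀ ≠ 0 := fun h ↦ hψ₀ (by rw [(φ X).map_eq_zero_iff.1 h]; rfl)
  obtain ⟨_, ⟨θ, hθ, rfl⟩, hmin⟩ := WellFounded.has_min
    (wellFounded_lt (α := Submodule R (S ⟶ X)))
    {P | ∃ θ : S ⟶ X, θ ≠ 0 ∧ LinearMap.range (Linear.rightComp R S θ) = P} ⟨_, _, hne, rfl⟩
  have hsimple (s : S ⟶ S) (hs : s ≫ θ ≠ 0) (t : S ⟶ S) : ∃ a : S ⟶ S, a ≫ s ≫ θ = t ≫ θ := by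
    have hle : LinearMap.range (Linear.rightComp R S (s ≫ θ)) ≤
        LinearMap.range (Linear.rightComp R S θ) := by
      rintro _ ⟨a, rfl⟩
      exact ⟨a ≫ s, by simp⟩
    have heq := eq_of_le_of_not_lt hle (hmin _ ⟨_, hs, rfl⟩)
    have : t ≫ θ ∈ LinearMap.range (Linear.rightComp R S (s ≫ θ)) := heq ▸ ⟨t, rfl⟩
    exact this
  obtain ⟨n, f, ⟨e⟩, hf⟩ := hKS S
  obtain ⟨i, hi⟩ : ∃ i, (biproduct.ι f i ≫ e.inv) ≫ θ ≠ 0 := by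
    by_contra! h
    apply hθ
    rw [← cancel_epi e.inv, comp_zero]
    exact biproduct.hom_ext' _ _ fun j ↦ by simpa using h j
  have hloc := hasLocalEnd_of_isLocalRing (hf i)
  refine ⟨f i, (biproduct.ι f i ≫ e.inv) ≫ θ, hloc, hi, fun Y γ hγ ↦ ?_⟩
  have hret : (biproduct.ι f i ≫ e.inv) ≫ e.hom ≫ biproduct.π f i = 𝟙 _ := by simp
  generalize biproduct.ι f i ≫ e.inv = ι at *
  generalize e.hom ≫ biproduct.π f i = π at *
  by_contra h0
  obtain ⟨ψ, hψ⟩ := hE.exists_apply_ne_zero_s9 (R := R) h0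
  have h1 : (φ Y ψ ≫ γ ≫ ι) ≫ θ ≠ 0 := fun h ↦ hψ <| by
    rw [hη ψ, LinearMap.comp_apply, Linear.leftComp_apply]
    rw [Category.assoc, Category.assoc] at h
    rw [h, map_zero]
  obtain ⟨a, ha⟩ := hsimple _ h1 (π ≫ ι)
  have hb : (ι ≫ a ≫ φ Y ψ ≫ γ) ≫ ι ≫ θ = ι ≫ θ := by
    simp only [Category.assoc] at ha ⊢
    rw [ha, ← Category.assoc, hret, Category.id_comp]
  have : IsIso (ι ≫ a ≫ φ Y ψ ≫ γ) := hloc.isIso_of_comp_eq hi hb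
  refine hγ ⟨⟨⟨inv (ι ≫ a ≫ φ Y ψ ≫ γ) ≫ ι ≫ a ≫ φ Y ψ, ?_⟩⟩⟩
  simp only [Category.assoc]
  exact IsIso.inv_hom_id _

end LocalObjects

section Triangulated

variable {C : Type v} [Category.{w} C] [Preadditive C] [HasZeroObject C] [HasShift C ℤ]
  [∀ n : ℤ, (shiftFunctor C n).Additive] [Pretriangulated C]

lemma isIso_of_indecomposable_of_split {A X : C} (hX : Indecomposable X) (hA : ¬IsZero A)
    (i : A ⟶ X) (p : X ⟶ A) (h : i ≫ p = 𝟙 A) : IsIso i := by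
  obtain ⟨B, f, g, hT⟩ := distinguished_cocone_triangle i
  have hg : g = 0 := by
    have : Mono i := mono_of_mono_fac h
    exact Triangle.mor₃_eq_zero_of_mono₁ _ hT this
  obtain ⟨e, -, -⟩ := exists_iso_binaryBiproduct_of_distTriang _ hT hg
  exact (Triangle.isZero₃_iff_isIso₁ _ hT).1 ((hX.2 _ _ e).resolve_left hA)

lemma IsKrullSchmidt.hasLocalEnd [HasFiniteBiproducts C] (hKS : IsKrullSchmidt C) {X : C}
    (hX : Indecomposable X) : HasLocalEnd X := by
  obtain ⟨n, f, ⟨e⟩, hf⟩ := hKS X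
  obtain ⟨i⟩ : Nonempty (Fin n) := by
    by_contra hn
    rw [not_nonempty_iff] at hn
    refine hX.1 (IsZero.of_iso ?_ e)
    rw [IsZero.iff_id_eq_zero]
    exact biproduct.hom_ext' _ _ fun j ↦ hn.elim j
  have hloc := hasLocalEnd_of_isLocalRing (hf i)
  have := isIso_of_indecomposable_of_split hX hloc.1 (biproduct.ι f i ≫ e.inv)
    (e.hom ≫ biproduct.π f i) (by simp)
  exact hloc.of_iso (asIso (biproduct.ι f i ≫ e.inv))

namespace IsAlmostVanishing

variable {L X : C} {θ : L ⟶ X}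

lemma exists_comp_eq (hθ : IsAlmostVanishing θ) {Y : C} {f : L ⟶ Y} (hf : f ≠ 0) :
    ∃ g : Y ⟶ X, θ = f ≫ g := by
  obtain ⟨V, q, h, hT⟩ := distinguished_cocone_triangle₁ f
  refine Triangle.yoneda_exact₂ _ hT θ (hθ.2 q fun hq ↦ hf ?_)
  have : q ≫ f = 0 := comp_distTriang_mor_zero₁₂ _ hT
  rw [← cancel_epi q, this, comp_zero]

lemma comp_eq_zero (hθ : IsAlmostVanishing θ) (hX : HasLocalEnd X) {W : C} {g : X ⟶ W}
    (hg : ¬IsSplitMono g) : θ ≫ g = 0 := by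
  by_contra h
  obtain ⟨k, hk⟩ := hθ.exists_comp_eq h
  have : IsIso (g ≫ k) := hX.isIso_of_comp_eq' hθ.1 (by rw [← Category.assoc, ← hk])
  exact hg ⟨⟨⟨k ≫ inv (g ≫ k), by rw [← Category.assoc, IsIso.hom_inv_id]⟩⟩⟩

lemma exists_eq_comp (hθ : IsAlmostVanishing θ) (hX : HasLocalEnd X) {Y : C} {g : Y ⟶ X}
    (hg : g ≠ 0) : ∃ f : L ⟶ Y, θ = f ≫ g := by
  obtain ⟨W, p, h, hT⟩ := distinguished_cocone_triangle g
  refine Triangle.coyoneda_exact₂ _ hT θ (hθ.comp_eq_zero hX fun (hp : IsSplitMono p) ↦ hg ?_)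
  have : g ≫ p = 0 := comp_distTriang_mor_zero₁₂ _ hT
  rw [← cancel_mono p, this, zero_comp]

variable {R : Type u} [CommRing R] [IsArtinianRing R] {E : Type u} [AddCommGroup E] [Module R E]
  [CategoryTheory.Linear R C] [∀ X Y : C, Module.Finite R (X ⟶ Y)]

lemma memL (hθ : IsAlmostVanishing θ) (hX : HasLocalEnd X)
    (hE : IsMinimalInjectiveCogenerator R E) : MemL R E X := by
  obtain ⟨η, hη⟩ := hE.exists_apply_ne_zero_s9 hθ.1
  let e (Y : C) : (L ⟶ Y) →ₗ[R] (Y ⟶ X) →ₗ[R] E := (Linear.comp L Y X).compr₂ η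
  have he (Y : C) (f : L ⟶ Y) (g : Y ⟶ X) : e Y f g = η (f ≫ g) := rfl
  have inj (Y : C) : Function.Injective (e Y) := by
    rw [injective_iff_map_eq_zero]
    intro f hf
    by_contra hf0
    obtain ⟨g, hg⟩ := hθ.exists_comp_eq hf0
    exact hη (by rw [hg, ← he, hf, LinearMap.zero_apply])
  have inj' (Y : C) : Function.Injective (e Y).flip := by
    rw [injective_iff_map_eq_zero]
    intro g hg
    by_contra hg0
    obtain ⟨f, hf⟩ := hθ.exists_eq_comp hX hg0
    exact hη (by rw [hf, ← he, ← LinearMap.flip_apply, hg, LinearMap.zero_apply])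
  have bij (Y : C) : Function.Bijective (e Y) :=
    ⟨inj Y, hE.surjective_of_injective_of_injective (e Y) (inj Y) (inj' Y)⟩
  refine ⟨L, fun Y ↦ (LinearEquiv.ofBijective (e Y) (bij Y)).symm, fun Y Y' g ψ ↦ ?_⟩
  obtain ⟨f, rfl⟩ := (bij Y).2 ψ
  beta_reduce
  rw [LinearEquiv.ofBijective_symm_apply_apply, LinearEquiv.symm_apply_eq]
  ext h
  simp [he]

end IsAlmostVanishing

lemma IsAlmostVanishing.exists_isARTriangle {L X : C} {θ : L ⟶ X} (hθ : IsAlmostVanishing θ)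
    (hL : HasLocalEnd L) (hX : Indecomposable X) :
    ∃ T : Triangle C, IsARTriangle C T ∧ T.obj₁ = X := by
  let F := shiftFunctor C (1 : ℤ)
  obtain ⟨Y, f, g, hT⟩ := distinguished_cocone_triangle₂ (F.map θ)
  refine ⟨_, ⟨hT, hX, (hL.map F).indecomposable, ?_, fun W γ hγ ↦ ?_⟩, rfl⟩
  · intro h
    change F.map θ = 0 at h
    exact hθ.1 (F.map_injective (by rw [h, F.map_zero]))
  · change W ⟶ F.obj L at γ
    change γ ≫ F.map θ = 0
    obtain ⟨γ', hγ'⟩ := F.map_surjective ((F.objObjPreimageIso W).hom ≫ γ)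
    rw [← cancel_epi (F.objObjPreimageIso W).hom, ← Category.assoc, ← hγ', ← F.map_comp,
      hθ.2 γ' fun h ↦ hγ ?_, F.map_zero, comp_zero]
    refine ⟨⟨⟨F.map (section_ γ') ≫ (F.objObjPreimageIso W).hom, ?_⟩⟩⟩
    change (F.map (section_ γ') ≫ (F.objObjPreimageIso W).hom) ≫ γ = 𝟙 (F.obj L)
    rw [Category.assoc, ← hγ', ← F.map_comp, IsSplitEpi.id, F.map_id]

lemma IsARTriangle.exists_isAlmostVanishing {T : Triangle C} (hT : IsARTriangle C T) :
    ∃ (L : C) (θ : L ⟶ T.obj₁), IsAlmostVanishing θ := by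
  obtain ⟨-, -, -, hw, hγ⟩ := hT
  let F := shiftFunctor C (1 : ℤ)
  let e := F.objObjPreimageIso T.obj₃
  obtain ⟨θ, hθ⟩ : ∃ θ : F.objPreimage T.obj₃ ⟶ T.obj₁, F.map θ = e.hom ≫ T.mor₃ :=
    F.map_surjective _
  refine ⟨_, θ, fun h ↦ hw ?_, fun Y γ h ↦ F.map_injective ?_⟩
  · rw [← cancel_epi e.hom, ← hθ, h, F.map_zero, comp_zero]
  · rw [F.map_comp, hθ, F.map_zero, ← Category.assoc]
    refine hγ _ fun hs ↦ h ?_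
    obtain ⟨s, hs'⟩ := F.map_surjective (e.hom ≫ section_ (F.map γ ≫ e.hom))
    refine ⟨⟨⟨s, F.map_injective ?_⟩⟩⟩
    rw [F.map_comp, hs', F.map_id, ← cancel_mono e.hom]
    simp

end Triangulated

/-- **Proposition 2.8(2)**: in a Hom-finite Krull-Schmidt `R`-linear triangulated category,
an indecomposable object `X` lies in `T_l` if and only if there is an Auslander-Reiten
triangle with `X` as its first term. -/
theorem memL_iff_exists_ARTriangle_first_term
    (R : Type u) [CommRing R] [IsArtinianRing R]
    (E : Type u) [AddCommGroup E] [Module R E]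
    (hE : IsMinimalInjectiveCogenerator R E)
    (C : Type v) [Category.{w} C] [Preadditive C] [CategoryTheory.Linear R C]
    [HasZeroObject C] [HasShift C ℤ] [∀ n : ℤ, (shiftFunctor C n).Additive]
    [Pretriangulated C] [HasFiniteBiproducts C]
    [∀ X Y : C, Module.Finite R (X ⟶ Y)]
    (hKS : IsKrullSchmidt C)
    (X : C) (hX : Indecomposable X) :
    MemL R E X ↔ ∃ T : Triangle C, IsARTriangle C T ∧ T.obj₁ = X := by
  constructor
  · intro h
    obtain ⟨L, θ, hL, hθ⟩ := h.exists_isAlmostVanishing hE hKS hX.1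
    exact hθ.exists_isARTriangle hL hX
  · rintro ⟨T, hT, rfl⟩
    obtain ⟨L, θ, hθ⟩ := hT.exists_isAlmostVanishing
    exact hθ.memL (hKS.hasLocalEnd hX) hE

end GeneralizedSerreDuality
end
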